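/- For every positive integer r and every integer k ≥ 2 there exists a real constant B̄_{k,r} with B̄_{k,r} ≥ −((2 + ⌊r/2⌋)/(k+1) + ln(k+1)/(2 ln 2)) such that for every integer p ≥ 1 with m := 2^p·(k+1) − 2 > r, one has H(m−r, m) ≥ (m+2)·ln(m+2)/(2 ln 2) + B̄_{k,r}·(m+2) + 2 + ⌊r/2⌋. -/

import Mathlib

open Filter Polynomial

/-- `Γ` is a periodic orbit of the planar vector field `V`: the image of a
nonconstant periodic solution of `γ' = V ∘ γ`. -/
def IsPeriodicOrbit (V : ℝ × ℝ → ℝ × ℝ) (Γ : Set (ℝ × ℝ)) : Prop :=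
  ∃ γ : ℝ → ℝ × ℝ,
    (∀ t : ℝ, HasDerivAt γ (V (γ t)) t) ∧
    (∃ T : ℝ, 0 < T ∧ Function.Periodic γ T) ∧
    (∃ t₁ t₂ : ℝ, γ t₁ ≠ γ t₂) ∧
    Γ = Set.range γ

/-- `Γ` is a limit cycle of `V`: a periodic orbit which is isolated among
periodic orbits. -/
def IsLimitCycle (V : ℝ × ℝ → ℝ × ℝ) (Γ : Set (ℝ × ℝ)) : Prop :=
  IsPeriodicOrbit V Γ ∧
  ∃ U : Set (ℝ × ℝ), IsOpen U ∧ Γ ⊆ U ∧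
    ∀ Γ' : Set (ℝ × ℝ), IsPeriodicOrbit V Γ' → Γ' ⊆ U → Γ' = Γ

/-- The Liénard vector field `ẋ = y, ẏ = -g(x) - ε f(x) y`. -/
def lienard (f g : Polynomial ℝ) (ε : ℝ) : ℝ × ℝ → ℝ × ℝ :=
  fun p => (p.2, -(g.eval p.1) - ε * (f.eval p.1) * p.2)

/-- `HGe n m c` formalizes `H(n,m) ≥ c`: there are polynomials `f, g` with
`deg f ≤ n`, `deg g ≤ m` and `ε₀ > 0` such that for every `0 < ε ≤ ε₀` the
Liénard system has at least `c` pairwise distinct limit cycles. -/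
def HGe (n m : ℕ) (c : ℝ) : Prop :=
  ∃ f g : Polynomial ℝ, f.natDegree ≤ n ∧ g.natDegree ≤ m ∧
    ∃ ε₀ : ℝ, 0 < ε₀ ∧ ∀ ε : ℝ, 0 < ε → ε ≤ ε₀ →
      ∃ S : Finset (Set (ℝ × ℝ)),
        (∀ Γ ∈ S, IsLimitCycle (lienard f g ε) Γ) ∧ c ≤ (S.card : ℝ)

namespace Lienard

open Set MeasureTheory
open scoped Topology unitInterval

/-- The Volterra operator `u ↦ ∫₀ᵗ u` on continuous functions on the unit interval. -/
noncomputable def primitive : C(I, ℝ) →L[ℝ] C(I, ℝ) :=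
  LinearMap.mkContinuous
    { toFun := fun u =>
        ⟨fun t => ∫ s in (0 : ℝ)..t, IccExtend zero_le_one u s, by
          have h : Continuous (IccExtend (zero_le_one (α := ℝ)) u) := u.continuous.Icc_extend'
          exact (intervalIntegral.continuous_primitive
            (fun a b => h.intervalIntegrable a b) 0).comp continuous_subtype_val⟩
      map_add' := fun u v => by
        ext t
        have hu : Continuous (IccExtend (zero_le_one (α := ℝ)) u) := u.continuous.Icc_extend'
        have hv : Continuous (IccExtend (zero_le_one (α := ℝ)) v) := v.continuous.Icc_extend'
        exact intervalIntegral.integral_add (hu.intervalIntegrable _ _) (hv.intervalIntegrable _ _)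
      map_smul' := fun c u => by
        ext t
        exact intervalIntegral.integral_const_mul c _ }
    1 fun u => by
      rw [one_mul, ContinuousMap.norm_le _ (norm_nonneg _)]
      intro t
      have h := intervalIntegral.norm_integral_le_of_norm_le_const (a := (0 : ℝ)) (b := t)
        (f := IccExtend zero_le_one u) (C := ‖u‖) fun s _ => u.norm_coe_le_norm _
      refine h.trans (mul_le_of_le_one_right (norm_nonneg _) ?_)
      rw [sub_zero, abs_of_nonneg t.2.1]
      exact t.2.2

theorem primitive_apply (u : C(I, ℝ)) (t : I) :
    primitive u t = ∫ s in (0 : ℝ)..t, IccExtend zero_le_one u s := rfl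

theorem abs_primitive_le {u : C(I, ℝ)} {M : ℝ} {n : ℕ}
    (h : ∀ t : I, |u t| ≤ M * (t : ℝ) ^ n) (t : I) :
    |primitive u t| ≤ M / (n + 1) * (t : ℝ) ^ (n + 1) := by
  have hu : Continuous (IccExtend (zero_le_one (α := ℝ)) u) := u.continuous.Icc_extend'
  rw [primitive_apply]
  calc |∫ s in (0 : ℝ)..t, IccExtend zero_le_one u s|
      ≤ ∫ s in (0 : ℝ)..t, |IccExtend zero_le_one u s| :=
        intervalIntegral.abs_integral_le_integral_abs t.2.1
    _ ≤ ∫ s in (0 : ℝ)..t, M * s ^ n := by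
        refine intervalIntegral.integral_mono_on t.2.1 (hu.abs.intervalIntegrable _ _)
          (Continuous.intervalIntegrable (by fun_prop) _ _) fun s hs => ?_
        have hs' : s ∈ Icc (0 : ℝ) 1 := ⟨hs.1, hs.2.trans t.2.2⟩
        rw [IccExtend_of_mem _ _ hs']
        exact h ⟨s, hs'⟩
    _ = M / (n + 1) * (t : ℝ) ^ (n + 1) := by
        rw [intervalIntegral.integral_const_mul, integral_pow]
        simp
        ring

theorem contDiff_aeval (p : ℝ[X]) :
    ContDiff ℝ 1 (fun u : C(I, ℝ) => aeval u p) := by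
  induction p using Polynomial.induction_on' with
  | add p q hp hq => simpa using hp.add hq
  | monomial n a =>
    simp only [aeval_monomial]
    exact contDiff_const.mul (contDiff_id.pow n)

theorem hasFDerivAt_aeval (p : ℝ[X]) (u : C(I, ℝ)) :
    HasFDerivAt (fun u : C(I, ℝ) => aeval u p)
      (ContinuousLinearMap.mul ℝ C(I, ℝ) (aeval u (derivative p))) u := by
  induction p using Polynomial.induction_on' with
  | add p q hp hq =>
    simp only [map_add]
    exact hp.add hq
  | monomial n a =>
    simp only [aeval_monomial, derivative_monomial]
    refine (((hasFDerivAt_id u).pow n).const_mul (algebraMap ℝ C(I, ℝ) a)).congr_fderiv ?_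
    ext v t
    simp [Algebra.algebraMap_eq_smul_one]
    ring

/-- An operator of Volterra type differs from the identity by an invertible operator. -/
theorem isUnit_one_sub_of_volterra (K : (C(I, ℝ) × C(I, ℝ)) →L[ℝ] (C(I, ℝ) × C(I, ℝ))) {C : ℝ}
    (hC : 0 ≤ C)
    (hK : ∀ (v : C(I, ℝ) × C(I, ℝ)) (M : ℝ) (n : ℕ), 0 ≤ M →
      (∀ t : I, |v.1 t| ≤ M * (t : ℝ) ^ n ∧ |v.2 t| ≤ M * (t : ℝ) ^ n) →
      ∀ t : I, |(K v).1 t| ≤ C * M / (n + 1) * (t : ℝ) ^ (n + 1) ∧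
        |(K v).2 t| ≤ C * M / (n + 1) * (t : ℝ) ^ (n + 1)) :
    IsUnit (1 - K) := by
  have hiter : ∀ (v : C(I, ℝ) × C(I, ℝ)) (n : ℕ) (t : I),
      |((K ^ n) v).1 t| ≤ C ^ n / n.factorial * ‖v‖ * (t : ℝ) ^ n ∧
        |((K ^ n) v).2 t| ≤ C ^ n / n.factorial * ‖v‖ * (t : ℝ) ^ n := by
    intro v n
    induction n with
    | zero =>
      intro t
      simp only [pow_zero, Nat.factorial_zero, Nat.cast_one, div_one, one_mul, mul_one]
      exact ⟨(v.1.norm_coe_le_norm t).trans (norm_fst_le v),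
        (v.2.norm_coe_le_norm t).trans (norm_snd_le v)⟩
    | succ n ih =>
      intro t
      have h := hK ((K ^ n) v) (C ^ n / n.factorial * ‖v‖) n (by positivity) ih t
      have e : C * (C ^ n / n.factorial * ‖v‖) / (n + 1) =
          C ^ (n + 1) / (n + 1).factorial * ‖v‖ := by
        rw [Nat.factorial_succ]
        push_cast
        field_simp
        ring
      rw [e] at h
      rw [pow_succ' K n]
      exact h
  have hnorm : ∀ n : ℕ, ‖K ^ n‖ ≤ C ^ n / n.factorial := by
    intro n
    refine ContinuousLinearMap.opNorm_le_bound _ (by positivity) fun v => ?_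
    have hb : 0 ≤ C ^ n / n.factorial * ‖v‖ := by positivity
    have key : ∀ t : I, C ^ n / n.factorial * ‖v‖ * (t : ℝ) ^ n ≤ C ^ n / n.factorial * ‖v‖ :=
      fun t => mul_le_of_le_one_right hb (pow_le_one₀ t.2.1 t.2.2)
    rw [Prod.norm_def]
    refine max_le ?_ ?_
    · rw [ContinuousMap.norm_le _ hb]
      exact fun t => (hiter v n t).1.trans (key t)
    · rw [ContinuousMap.norm_le _ hb]
      exact fun t => (hiter v n t).2.trans (key t)
  obtain ⟨n, hn⟩ : ∃ n : ℕ, C ^ n / n.factorial < 1 :=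
    ((FloorSemiring.tendsto_pow_div_factorial_atTop C).eventually_lt_const one_pos).exists
  have hunit : IsUnit (1 - K ^ n) := by
    have h := (hnorm n).trans_lt hn
    generalize K ^ n = N at h
    exact (Units.oneSub N h).isUnit
  have hcomm : (1 - K) * (∑ i ∈ Finset.range n, K ^ i) = 1 - K ^ n := mul_neg_geom_sum K n
  have hcomm' : (∑ i ∈ Finset.range n, K ^ i) * (1 - K) = 1 - K ^ n := geom_sum_mul_neg K n
  rw [← hcomm] at hunit
  exact ((show Commute (1 - K) (∑ i ∈ Finset.range n, K ^ i) from
    hcomm.trans hcomm'.symm).isUnit_mul_iff.1 hunit).1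

/-- The integral equation of the Liénard system on the rescaled time interval `[0, 1]`, for the
solution of period parameter `T` issued from `(a, 0)`. Parameters are `((a, ε), T)`. -/
noncomputable def integralEq (f g : ℝ[X])
    (w : ((ℝ × ℝ) × ℝ) × (C(I, ℝ) × C(I, ℝ))) : C(I, ℝ) × C(I, ℝ) :=
  (w.2.1 - w.1.1.1 • (1 : C(I, ℝ)) - w.1.2 • primitive w.2.2,
   w.2.2 + w.1.2 • primitive (aeval w.2.1 g + w.1.1.2 • (aeval w.2.1 f * w.2.2)))

theorem contDiff_integralEq (f g : ℝ[X]) : ContDiff ℝ 1 (integralEq f g) := by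
  have hf := contDiff_aeval f
  have hg := contDiff_aeval g
  unfold integralEq
  fun_prop

/-- The restriction of `s ↦ x (T s)` to the unit interval, depending continuously on `T`. -/
noncomputable def samplePath (x : C(ℝ, ℝ)) : C(ℝ, C(I, ℝ)) :=
  ContinuousMap.curry ⟨fun p : ℝ × I => x (p.1 * p.2), by fun_prop⟩

@[simp]
theorem samplePath_apply (x : C(ℝ, ℝ)) (T : ℝ) (t : I) : samplePath x T t = x (T * t) := rfl

theorem smul_primitive_eq {x : ℝ → ℝ} {v : C(ℝ, ℝ)} (hx : ∀ t, HasDerivAt x (v t) t) (T : ℝ)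
    {u : C(I, ℝ)} (hu : ∀ t : I, u t = v (T * t)) (t : I) :
    T * primitive u t = x (T * t) - x 0 := by
  rw [primitive_apply, ← intervalIntegral.integral_const_mul]
  have h : ∀ s ∈ uIcc (0 : ℝ) t, HasDerivAt (fun s => x (T * s)) (v (T * s) * T) s := by
    intro s _
    simpa [Function.comp_def] using (hx (T * s)).comp s ((hasDerivAt_id s).const_mul T)
  have h2 := intervalIntegral.integral_eq_sub_of_hasDerivAt h
    (Continuous.intervalIntegrable (by fun_prop) _ _)
  simp only [mul_zero] at h2
  rw [← h2]
  refine intervalIntegral.integral_congr fun s hs => ?_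
  rw [uIcc_of_le t.2.1] at hs
  have hs' : s ∈ Icc (0 : ℝ) 1 := ⟨hs.1, hs.2.trans t.2.2⟩
  rw [IccExtend_of_mem _ _ hs', hu]
  ring

theorem integralEq_samplePath (f g : ℝ[X]) {x y : C(ℝ, ℝ)}
    (hx : ∀ t, HasDerivAt x (y t) t) (hy : ∀ t, HasDerivAt y (-g.eval (x t)) t)
    (hy0 : y 0 = 0) (T : ℝ) :
    integralEq f g (((x 0, 0), T), (samplePath x T, samplePath y T)) = 0 := by
  have h1 := smul_primitive_eq hx T (u := samplePath y T) (fun t => rfl)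
  have h2 := smul_primitive_eq (v := ⟨fun t => g.eval (x t), by fun_prop⟩)
    (x := fun t => -y t) (fun t => by simpa using! (hy t).neg) T
    (u := aeval (samplePath x T) g) (fun t => by simp)
  unfold integralEq
  ext t
  · simp [h1 t]
  · simp [h2 t, hy0]

theorem isInvertible_fderiv_integralEq (f g : ℝ[X]) (a T : ℝ) (w : C(I, ℝ) × C(I, ℝ)) :
    (fderiv ℝ (integralEq f g) (((a, 0), T), w) ∘L .inr ℝ _ _).IsInvertible := by
  set A : C(I, ℝ) := aeval w.1 (derivative g)
  let K : (C(I, ℝ) × C(I, ℝ)) →L[ℝ] (C(I, ℝ) × C(I, ℝ)) :=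
    (T • (primitive ∘L .snd ℝ C(I, ℝ) C(I, ℝ))).prod
      (-(T • (primitive ∘L (ContinuousLinearMap.mul ℝ C(I, ℝ) A) ∘L .fst ℝ C(I, ℝ) C(I, ℝ))))
  have hd : HasFDerivAt (fun w => integralEq f g (((a, 0), T), w)) (1 - K) w := by
    have h1 : HasFDerivAt (fun w : C(I, ℝ) × C(I, ℝ) =>
        w.1 - a • (1 : C(I, ℝ)) - T • primitive w.2)
        (.fst ℝ _ _ - T • (primitive ∘L .snd ℝ _ _)) w := by
      have := ((hasFDerivAt_fst (𝕜 := ℝ) (p := w)).sub_const (a • (1 : C(I, ℝ)))).sub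
        (((primitive ∘L .snd ℝ _ _).hasFDerivAt (x := w)).const_smul T)
      exact this
    have h2 : HasFDerivAt (fun w : C(I, ℝ) × C(I, ℝ) => w.2 + T • primitive (aeval w.1 g))
        (.snd ℝ _ _ + T • (primitive ∘L (ContinuousLinearMap.mul ℝ C(I, ℝ) A) ∘L .fst ℝ _ _))
        w := by
      have h3 := (hasFDerivAt_aeval g w.1).comp w (hasFDerivAt_fst (𝕜 := ℝ) (p := w))
      exact (hasFDerivAt_snd (𝕜 := ℝ) (p := w)).add
        ((primitive.hasFDerivAt.comp w h3).const_smul T)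
    refine (h1.prodMk h2).congr_of_eventuallyEq ?_ |>.congr_fderiv ?_
    · exact .of_forall fun w => by simp [integralEq]
    · ext v t <;> simp [K, sub_eq_add_neg]
  have he : fderiv ℝ (integralEq f g) (((a, 0), T), w) ∘L .inr ℝ _ _ = 1 - K := by
    have hc := ((contDiff_integralEq f g).differentiable one_ne_zero
      (((a, 0), T), w)).hasFDerivAt
    exact (hc.comp w (hasFDerivAt_prodMk_right ((a, (0 : ℝ)), T) w)).unique hd
  rw [he]
  have hu : IsUnit (1 - K) := by
    refine isUnit_one_sub_of_volterra K (C := |T| * (1 + ‖A‖)) (by positivity) ?_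
    intro v M n hM hv t
    have hb : ∀ (u : C(I, ℝ)) (M' : ℝ), 0 ≤ M' → M' ≤ (1 + ‖A‖) * M →
        (∀ t : I, |u t| ≤ M' * (t : ℝ) ^ n) →
        |T * primitive u t| ≤ |T| * (1 + ‖A‖) * M / (n + 1) * (t : ℝ) ^ (n + 1) := by
      intro u M' _ hM' hu
      rw [abs_mul]
      have ht : (0 : ℝ) ≤ t := t.2.1
      calc |T| * |primitive u t| ≤ |T| * (M' / (n + 1) * (t : ℝ) ^ (n + 1)) :=
            mul_le_mul_of_nonneg_left (abs_primitive_le hu t) (abs_nonneg T)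
        _ ≤ |T| * ((1 + ‖A‖) * M / (n + 1) * (t : ℝ) ^ (n + 1)) := by gcongr
        _ = _ := by ring
    have hA := norm_nonneg A
    constructor
    · simpa [K] using hb v.2 M hM (by nlinarith) fun t => (hv t).2
    · have := hb (A * v.1) (‖A‖ * M) (by positivity) (by nlinarith) fun t => by
        rw [ContinuousMap.mul_apply, abs_mul, mul_assoc]
        exact mul_le_mul (A.norm_coe_le_norm t) (hv t).1 (abs_nonneg _) hA
      simpa [K] using this
  obtain ⟨u, hu⟩ := hu
  rw [← hu]
  exact ⟨ContinuousLinearEquiv.ofUnit u, rfl⟩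

/-- Strictly differentiable dependence of the solutions of the Liénard system on the initial
abscissa, on `ε` and on the time, near a solution of the Hamiltonian system. -/
theorem exists_solution_map (f g : ℝ[X]) {x y : C(ℝ, ℝ)}
    (hx : ∀ t, HasDerivAt x (y t) t) (hy : ∀ t, HasDerivAt y (-g.eval (x t)) t)
    (hy0 : y 0 = 0) (T : ℝ) :
    ∃ S : (ℝ × ℝ) × ℝ → C(I, ℝ) × C(I, ℝ),
      (∃ S' : ((ℝ × ℝ) × ℝ) →L[ℝ] (C(I, ℝ) × C(I, ℝ)), HasStrictFDerivAt S S' ((x 0, 0), T)) ∧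
      (∀ᶠ q in 𝓝 (((x 0, 0), T) : (ℝ × ℝ) × ℝ), integralEq f g (q, S q) = 0) ∧
      ∀ᶠ t in 𝓝 T, S ((x 0, 0), t) = (samplePath x t, samplePath y t) := by
  set u : ((ℝ × ℝ) × ℝ) × (C(I, ℝ) × C(I, ℝ)) :=
    (((x 0, 0), T), (samplePath x T, samplePath y T)) with hu
  have h0 : ∀ t, integralEq f g (((x 0, 0), t), (samplePath x t, samplePath y t)) = 0 :=
    integralEq_samplePath f g hx hy hy0
  have hs : HasStrictFDerivAt (integralEq f g) (fderiv ℝ (integralEq f g) u) u :=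
    (contDiff_integralEq f g).contDiffAt.hasStrictFDerivAt one_ne_zero
  have hi := isInvertible_fderiv_integralEq f g (x 0) T (samplePath x T, samplePath y T)
  refine ⟨hs.implicitFunctionOfProdDomain hi,
    ⟨_, hs.hasStrictFDerivAt_implicitFunctionOfProdDomain hi⟩, ?_, ?_⟩
  · filter_upwards [hs.eventually_apply_implicitFunctionOfProdDomain hi] with q hq
    rw [hq, hu, h0]
  · have hc : Tendsto (fun t : ℝ => ((((x 0, (0 : ℝ)), t), (samplePath x t, samplePath y t)) :
        ((ℝ × ℝ) × ℝ) × (C(I, ℝ) × C(I, ℝ)))) (𝓝 T) (𝓝 u) :=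
      Continuous.tendsto (by fun_prop) T
    filter_upwards [hc.eventually (hs.eventually_apply_eq_iff_implicitFunctionOfProdDomain hi)]
      with t ht
    exact ht.1 (by rw [h0, hu, h0])

/-- `a < b` are the turning points of a regular closed level curve of `y² / 2 + G(x)`. -/
structure Oval (G : ℝ[X]) (a b : ℝ) : Prop where
  lt : a < b
  eval_eq : G.eval a = G.eval b
  eval_lt : ∀ x ∈ Ioo a b, G.eval x < G.eval a
  deriv_left : (derivative G).eval a < 0
  deriv_right : 0 < (derivative G).eval b

/-- The Abelian integral `∫ f y dx` over the upper half of the oval with turning points `a, b`. -/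
noncomputable def abelian (G f : ℝ[X]) (a b : ℝ) : ℝ :=
  ∫ x in a..b, f.eval x * √(2 * (G.eval a - G.eval x))

theorem Oval.exists_factor {G : ℝ[X]} {a b : ℝ} (h : Oval G a b) :
    ∃ q : ℝ[X], (∀ x, G.eval a - G.eval x = (x - a) * (b - x) * q.eval x) ∧
      ∀ x ∈ Icc a b, 0 < q.eval x := by
  obtain ⟨p₁, hp₁⟩ : X - C a ∣ C (G.eval a) - G := by
    rw [dvd_iff_isRoot]; simp
  have hb : p₁.IsRoot b := by
    have h1 := congrArg (eval b) hp₁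
    simp only [eval_sub, eval_C, h.eval_eq, sub_self, eval_mul, eval_X] at h1
    exact (mul_eq_zero.1 h1.symm).resolve_left (sub_ne_zero.2 h.lt.ne')
  obtain ⟨p₂, hp₂⟩ := dvd_iff_isRoot.2 hb
  have hG : C (G.eval a) - G = (X - C a) * ((C b - X) * (-p₂)) := by
    rw [hp₁, hp₂]; ring
  have he : ∀ x, G.eval a - G.eval x = (x - a) * (b - x) * (-p₂).eval x := fun x => by
    have := congrArg (eval x) hG
    simp only [eval_sub, eval_C, eval_mul, eval_X] at this
    rw [this]; ring
  have hd : ∀ x, -(derivative G).eval x =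
      (b - x) * (-p₂).eval x - (x - a) * (-p₂).eval x
        + (x - a) * (b - x) * (derivative (-p₂)).eval x := fun x => by
    have := congrArg (fun p => (derivative p).eval x) hG
    simp only [derivative_sub, derivative_C, derivative_mul, derivative_X, eval_sub, eval_zero,
      eval_mul, eval_add, eval_X, eval_C, eval_one] at this
    rw [zero_sub] at this
    rw [this]; ring
  refine ⟨-p₂, he, fun x hx => ?_⟩
  have hab := sub_pos.2 h.lt
  rcases eq_or_lt_of_le hx.1 with rfl | hax
  · have := hd a
    have h2 := h.deriv_left
    simp only [sub_self, zero_mul, sub_zero, add_zero] at this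
    exact pos_of_mul_pos_right (this ▸ neg_pos.2 h2) hab.le
  rcases eq_or_lt_of_le hx.2 with rfl | hxb
  · have := hd x
    have h2 := h.deriv_right
    simp only [sub_self, zero_mul, mul_zero, zero_sub, add_zero, neg_inj] at this
    exact pos_of_mul_pos_right (this ▸ h2) hab.le
  · have h1 := h.eval_lt x ⟨hax, hxb⟩
    have h2 := he x
    exact pos_of_mul_pos_right (h2 ▸ sub_pos.2 h1)
      (mul_pos (sub_pos.2 hax) (sub_pos.2 hxb)).le

/-- A positive scalar periodic equation `θ' = ω(θ)` has a global increasing solution. -/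
theorem exists_phase {ω : ℝ → ℝ} (hω : Continuous ω) {M c : ℝ} (hc : 0 < c)
    (hlow : ∀ θ, c ≤ ω θ) (hM : ∀ θ, ω θ ≤ M) (hper : Function.Periodic ω (2 * Real.pi)) :
    ∃ (Θ τ : ℝ → ℝ), (∀ t, HasDerivAt Θ (ω (Θ t)) t) ∧ (∀ θ, HasDerivAt τ (ω θ)⁻¹ θ) ∧
      τ 0 = 0 ∧ (∀ t, τ (Θ t) = t) ∧ (∀ θ, Θ (τ θ) = θ) ∧ 0 < τ (2 * Real.pi) ∧
      (∀ t, Θ (t + τ (2 * Real.pi)) = Θ t + 2 * Real.pi) ∧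
      ∀ n : ℤ, τ (n * (2 * Real.pi)) = n * τ (2 * Real.pi) := by
  have hpos : ∀ θ, 0 < ω θ := fun θ => hc.trans_le (hlow θ)
  have hMpos : 0 < M := (hpos 0).trans_le (hM 0)
  have hinv : Continuous fun θ => (ω θ)⁻¹ := hω.inv₀ fun θ => (hpos θ).ne'
  set τ : ℝ → ℝ := fun θ => ∫ s in (0 : ℝ)..θ, (ω s)⁻¹ with hτ
  have hωi : ∀ a b, IntervalIntegrable (fun θ => (ω θ)⁻¹) volume a b :=
    fun a b => hinv.intervalIntegrable a b
  have hd : ∀ θ, HasDerivAt τ (ω θ)⁻¹ θ := fun θ =>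
    intervalIntegral.integral_hasDerivAt_right (hωi _ _)
      (hinv.stronglyMeasurableAtFilter _ _) hinv.continuousAt
  have hτ0 : τ 0 = 0 := by simp [hτ]
  have hmono : StrictMono τ := strictMono_of_deriv_pos fun θ => by
    rw [(hd θ).deriv]; exact inv_pos.2 (hpos θ)
  have hcont : Continuous τ := continuous_iff_continuousAt.2 fun θ => (hd θ).continuousAt
  have hadd : ∀ θ, τ (θ + 2 * Real.pi) = τ θ + τ (2 * Real.pi) := by
    intro θ
    have hp : Function.Periodic (fun θ => (ω θ)⁻¹) (2 * Real.pi) := fun θ => by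
      simp only [hper θ]
    have h1 := hp.intervalIntegral_add_eq θ 0
    rw [zero_add] at h1
    simp only [hτ]
    rw [← h1, intervalIntegral.integral_add_adjacent_intervals (hωi _ _) (hωi _ _)]
  have hT : 0 < τ (2 * Real.pi) := by
    rw [← hτ0]; exact hmono Real.two_pi_pos
  have hz : ∀ n : ℤ, τ (n * (2 * Real.pi)) = n * τ (2 * Real.pi) := by
    intro n
    induction n using Int.induction_on with
    | zero => simp [hτ0]
    | succ n ih =>
      push_cast at ih ⊢
      rw [add_mul, one_mul, hadd, ih]; ring
    | pred n ih =>
      have := hadd ((-(n : ℝ) - 1) * (2 * Real.pi))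
      push_cast at ih ⊢
      rw [show (-(n : ℝ) - 1) * (2 * Real.pi) + 2 * Real.pi = -n * (2 * Real.pi) by ring,
        ih] at this
      linarith
  have hsurj : Function.Surjective τ := by
    intro t
    obtain ⟨n, hn⟩ := exists_nat_ge (|t| / τ (2 * Real.pi))
    rw [div_le_iff₀ hT] at hn
    have h1 := hz n
    have h2 := hz (-n)
    push_cast at h1 h2
    have hmem : t ∈ Icc (τ (-n * (2 * Real.pi))) (τ (n * (2 * Real.pi))) := by
      rw [h1, h2]
      constructor <;> [have := neg_abs_le t; have := le_abs_self t] <;> linarith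
    have hle : -(n : ℝ) * (2 * Real.pi) ≤ n * (2 * Real.pi) := by
      have : (0 : ℝ) ≤ n * (2 * Real.pi) := by positivity
      linarith
    obtain ⟨θ, -, hθ⟩ := intermediate_value_Icc hle hcont.continuousOn hmem
    exact ⟨θ, hθ⟩
  let e := (hmono.orderIsoOfSurjective τ hsurj).toHomeomorph
  have he : ∀ θ, e θ = τ θ := fun θ => rfl
  refine ⟨e.symm, τ, fun t => ?_, hd, hτ0, fun t => e.apply_symm_apply t,
    fun θ => e.symm_apply_apply θ, hT, fun t => ?_, hz⟩
  · have := (hd (e.symm t)).of_local_left_inverse (g := e.symm) (a := t)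
      e.symm.continuous.continuousAt (inv_ne_zero (hpos _).ne')
      (.of_forall fun s => e.apply_symm_apply s)
    simpa using this
  · apply hmono.injective
    rw [hadd]
    change e (e.symm _) = e (e.symm _) + _
    rw [e.apply_symm_apply, e.apply_symm_apply]

theorem Oval.exists_orbit {G : ℝ[X]} {a b : ℝ} (h : Oval G a b) :
    ∃ (x y : C(ℝ, ℝ)) (T : ℝ), 0 < T ∧ (∀ t, HasDerivAt x (y t) t) ∧
      (∀ t, HasDerivAt y (-(derivative G).eval (x t)) t) ∧ x 0 = a ∧ y 0 = 0 ∧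
      (∀ t, x (t + T) = x t) ∧ (∀ t, y (t + T) = y t) ∧ (∀ t, x t ∈ Icc a b) ∧
      (∀ t, x t = a → ∃ n : ℤ, t = n * T) ∧
      (∀ t, y t ^ 2 / 2 + G.eval (x t) = G.eval a) ∧
      ∀ f : ℝ[X], ∫ t in (0 : ℝ)..T, f.eval (x t) * y t ^ 2 = 2 * abelian G f a b := by
  obtain ⟨q, hq, hqpos⟩ := h.exists_factor
  set m := (a + b) / 2 with hm
  set ρ := (b - a) / 2 with hρ
  have hρpos : 0 < ρ := by have := h.lt; rw [hρ]; linarith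
  have ha : a = m - ρ := by rw [hm, hρ]; ring
  have hb : b = m + ρ := by rw [hm, hρ]; ring
  set ξ : ℝ → ℝ := fun θ => m - ρ * Real.cos θ with hξ
  have hξmem : ∀ θ, ξ θ ∈ Icc a b := fun θ => by
    have h1 := mul_le_mul_of_nonneg_left (Real.cos_le_one θ) hρpos.le
    have h2 := mul_le_mul_of_nonneg_left (Real.neg_one_le_cos θ) hρpos.le
    constructor <;> simp only [hξ] <;> linarith
  have hξd : ∀ θ, HasDerivAt ξ (ρ * Real.sin θ) θ := fun θ => by
    simpa using! ((Real.hasDerivAt_cos θ).const_mul ρ).const_sub m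
  set ω : ℝ → ℝ := fun θ => √(2 * q.eval (ξ θ)) with hω
  have hqξ : ∀ θ, 0 < 2 * q.eval (ξ θ) := fun θ => mul_pos two_pos (hqpos _ (hξmem θ))
  have hωpos : ∀ θ, 0 < ω θ := fun θ => Real.sqrt_pos.2 (hqξ θ)
  have hωsq : ∀ θ, ω θ ^ 2 = 2 * q.eval (ξ θ) := fun θ => Real.sq_sqrt (hqξ θ).le
  have hξc : Continuous ξ := by fun_prop
  have hωc : Continuous ω := by fun_prop
  have hωper : Function.Periodic ω (2 * Real.pi) := fun θ => by
    simp only [hω, hξ, Real.cos_add_two_pi]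
  have hωd : ∀ θ, HasDerivAt ω ((derivative q).eval (ξ θ) * (ρ * Real.sin θ) / ω θ) θ := fun θ => by
    have h1 := (((q.hasDerivAt (ξ θ)).comp θ (hξd θ)).const_mul 2).sqrt (hqξ θ).ne'
    refine h1.congr_deriv ?_
    change 2 * _ / (2 * ω θ) = _
    have := (hωpos θ).ne'
    field_simp
  obtain ⟨c, hc, hlow⟩ : ∃ c > 0, ∀ θ, c ≤ ω θ := by
    obtain ⟨z, hz, hmin⟩ := isCompact_Icc.exists_isMinOn (nonempty_Icc.2 h.lt.le)
      (q.continuous.continuousOn (s := Icc a b))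
    exact ⟨√(2 * q.eval z), Real.sqrt_pos.2 (mul_pos two_pos (hqpos z hz)), fun θ =>
      Real.sqrt_le_sqrt (mul_le_mul_of_nonneg_left (hmin (hξmem θ)) two_pos.le)⟩
  obtain ⟨M, hM⟩ : ∃ M, ∀ θ, ω θ ≤ M := by
    obtain ⟨z, hz, hmax⟩ := isCompact_Icc.exists_isMaxOn (nonempty_Icc.2 h.lt.le)
      (q.continuous.continuousOn (s := Icc a b))
    exact ⟨√(2 * q.eval z), fun θ =>
      Real.sqrt_le_sqrt (mul_le_mul_of_nonneg_left (hmax (hξmem θ)) two_pos.le)⟩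
  obtain ⟨Θ, τ, hΘ, hτ, hτ0, hτΘ, hΘτ, hT, hΘT, hτn⟩ := exists_phase hωc hc hlow hM hωper
  have hΘ0 : Θ 0 = 0 := by have := hΘτ 0; rwa [hτ0] at this
  have hΘc : Continuous Θ := continuous_iff_continuousAt.2 fun t => (hΘ t).continuousAt
  have henergy : ∀ θ, (ρ * ω θ * Real.sin θ) ^ 2 = 2 * (G.eval a - G.eval (ξ θ)) := fun θ => by
    rw [hq, mul_pow, mul_pow, hωsq, Real.sin_sq, ha, hb]
    simp only [hξ]
    ring
  have hxd : ∀ t, HasDerivAt (fun t => ξ (Θ t)) (ρ * ω (Θ t) * Real.sin (Θ t)) t := fun t => by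
    refine ((hξd (Θ t)).comp t (hΘ t)).congr_deriv ?_
    ring
  refine ⟨⟨fun t => ξ (Θ t), by fun_prop⟩, ⟨fun t => ρ * ω (Θ t) * Real.sin (Θ t), by fun_prop⟩,
    τ (2 * Real.pi), hT, hxd, fun t => ?_, ?_, ?_, fun t => ?_, fun t => ?_, fun t => hξmem _,
    fun t ht => ?_, fun t => ?_, fun f => ?_⟩
  · have h1 := ((((hωd (Θ t)).const_mul ρ).mul (Real.hasDerivAt_sin (Θ t))).comp t (hΘ t))
    refine h1.congr_deriv ?_
    have hG : -(derivative G).eval (ξ (Θ t)) = (b - ξ (Θ t)) * q.eval (ξ (Θ t))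
        - (ξ (Θ t) - a) * q.eval (ξ (Θ t))
        + (ξ (Θ t) - a) * (b - ξ (Θ t)) * (derivative q).eval (ξ (Θ t)) := by
      have h2 : HasDerivAt (fun x => G.eval a - G.eval x) (-(derivative G).eval (ξ (Θ t)))
          (ξ (Θ t)) := (G.hasDerivAt _).const_sub _
      have h3 : HasDerivAt (fun x => (x - a) * (b - x) * q.eval x) _ (ξ (Θ t)) :=
        ((((hasDerivAt_id _).sub_const a).mul ((hasDerivAt_id _).const_sub b)).mul
          (q.hasDerivAt (ξ (Θ t))))
      rw [← funext hq] at h3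
      rw [h2.unique h3]
      simp
      ring
    simp only [ContinuousMap.coe_mk, hG]
    have h4 := hωsq (Θ t)
    have h5 := (hωpos (Θ t)).ne'
    have h6 : ξ (Θ t) = m - ρ * Real.cos (Θ t) := rfl
    have h7 := Real.sin_sq_add_cos_sq (Θ t)
    have h8 : q.eval (ξ (Θ t)) = ω (Θ t) ^ 2 / 2 := by linarith
    rw [h8, show b - ξ (Θ t) = ρ * (1 + Real.cos (Θ t)) by rw [h6, hb]; ring,
      show ξ (Θ t) - a = ρ * (1 - Real.cos (Θ t)) by rw [h6, ha]; ring]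
    field_simp
    linear_combination (ρ * eval (ξ (Θ t)) (derivative q) * 2) * h7
  · simp [hΘ0, hξ, ha]
  · simp [hΘ0]
  · simp [hΘT, hξ]
  · simp [hΘT, hωper (Θ t)]
  · have hcos : Real.cos (Θ t) = 1 := by
      have h1 : m - ρ * Real.cos (Θ t) = m - ρ := ht.trans ha
      have h2 : ρ * (Real.cos (Θ t) - 1) = 0 := by linarith
      linarith [(mul_eq_zero.1 h2).resolve_left hρpos.ne']
    obtain ⟨n, hn⟩ := (Real.cos_eq_one_iff _).1 hcos
    exact ⟨n, by rw [← hτn, hn, hτΘ]⟩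
  · simp only [ContinuousMap.coe_mk, henergy]
    ring
  · simp only [ContinuousMap.coe_mk]
    set φ : ℝ → ℝ := fun θ => f.eval (ξ θ) * (ρ ^ 2 * ω θ * Real.sin θ ^ 2) with hφ
    have hφc : Continuous φ := by fun_prop
    have h1 : ∫ t in (0 : ℝ)..τ (2 * Real.pi),
        f.eval (ξ (Θ t)) * (ρ * ω (Θ t) * Real.sin (Θ t)) ^ 2 =
          ∫ θ in (0 : ℝ)..2 * Real.pi, φ θ := by
      have := intervalIntegral.integral_comp_mul_deriv (a := 0) (b := 2 * Real.pi) (f := τ)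
        (g := fun t => f.eval (ξ (Θ t)) * (ρ * ω (Θ t) * Real.sin (Θ t)) ^ 2)
        (fun θ _ => hτ θ) (hωc.inv₀ fun θ => (hωpos θ).ne').continuousOn (by fun_prop)
      rw [hτ0] at this
      rw [← this]
      refine intervalIntegral.integral_congr fun θ _ => ?_
      simp only [Function.comp_apply, hΘτ, hφ]
      have := (hωpos θ).ne'
      field_simp
    have h2 : ∫ θ in Real.pi..2 * Real.pi, φ θ = ∫ θ in (0 : ℝ)..Real.pi, φ θ := by
      have h3 := intervalIntegral.integral_comp_sub_left (a := 0) (b := Real.pi) φ (2 * Real.pi)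
      rw [sub_zero, show 2 * Real.pi - Real.pi = Real.pi by ring] at h3
      rw [← h3]
      refine intervalIntegral.integral_congr fun θ _ => ?_
      simp only [hφ, hω, hξ, Real.cos_two_pi_sub, Real.sin_two_pi_sub, neg_sq]
    have h4 : ∫ θ in (0 : ℝ)..Real.pi, φ θ = abelian G f a b := by
      have := intervalIntegral.integral_comp_mul_deriv (a := 0) (b := Real.pi) (f := ξ)
        (g := fun x => f.eval x * √(2 * (G.eval a - G.eval x)))
        (fun θ _ => hξd θ) (by fun_prop) (by fun_prop)
      have e0 : ξ 0 = a := by simp [hξ, ha]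
      have e1 : ξ Real.pi = b := by simp [hξ, hb]
      rw [e0, e1] at this
      rw [abelian, ← this]
      refine intervalIntegral.integral_congr fun θ hθ => ?_
      rw [uIcc_of_le Real.pi_pos.le] at hθ
      have hs := Real.sin_nonneg_of_mem_Icc hθ
      simp only [Function.comp_apply, hφ]
      rw [← henergy θ, Real.sqrt_sq (mul_nonneg (mul_nonneg hρpos.le (hωpos θ).le) hs)]
      ring
    rw [h1, ← intervalIntegral.integral_add_adjacent_intervals
      (hφc.intervalIntegrable 0 Real.pi) (hφc.intervalIntegrable _ _), h2, h4]
    ring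

theorem contDiff_lienard (f g : ℝ[X]) (ε : ℝ) : ContDiff ℝ 1 (lienard f g ε) := by
  have h1 : ∀ p : ℝ[X], ContDiff ℝ 1 fun x : ℝ => p.eval x := fun p => by
    simpa using p.contDiff_aeval (R := ℝ) (𝕜 := ℝ) 1
  have hf := (h1 f).comp (contDiff_fst (𝕜 := ℝ) (E := ℝ) (F := ℝ))
  have hg := (h1 g).comp (contDiff_fst (𝕜 := ℝ) (E := ℝ) (F := ℝ))
  simp only [Function.comp_def] at hf hg
  unfold lienard
  fun_prop

theorem eqOn_of_hasDerivAt {E : Type*} [NormedAddCommGroup E] [NormedSpace ℝ E] [ProperSpace E]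
    {V : E → E} (hV : ContDiff ℝ 1 V) {u v : ℝ → E} {a b : ℝ}
    (hu : ∀ t ∈ Icc a b, HasDerivAt u (V (u t)) t) (hv : ∀ t ∈ Icc a b, HasDerivAt v (V (v t)) t)
    (h0 : u a = v a) : EqOn u v (Icc a b) := by
  have huc : ContinuousOn u (Icc a b) := fun t ht => (hu t ht).continuousAt.continuousWithinAt
  have hvc : ContinuousOn v (Icc a b) := fun t ht => (hv t ht).continuousAt.continuousWithinAt
  set s : Set E := u '' Icc a b ∪ v '' Icc a b with hs
  have hsc : IsCompact s := (isCompact_Icc.image_of_continuousOn huc).union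
    (isCompact_Icc.image_of_continuousOn hvc)
  have hloc : LocallyLipschitzOn s V := fun x _ => by
    obtain ⟨K, t, ht, hK⟩ := (hV.contDiffAt (x := x)).exists_lipschitzOnWith
    exact ⟨K, t, mem_nhdsWithin_of_mem_nhds ht, hK⟩
  obtain ⟨K, hK⟩ := hloc.exists_lipschitzOnWith_of_compact hsc
  exact ODE_solution_unique_of_mem_Icc_right (v := fun _ => V) (s := fun _ => s)
    (fun _ _ => hK) huc (fun t ht => (hu t (Ico_subset_Icc_self ht)).hasDerivWithinAt)
    (fun t ht => .inl ⟨t, Ico_subset_Icc_self ht, rfl⟩) hvc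
    (fun t ht => (hv t (Ico_subset_Icc_self ht)).hasDerivWithinAt)
    (fun t ht => .inr ⟨t, Ico_subset_Icc_self ht, rfl⟩) h0

/-- `u` parametrizes over `[0, 1]` an orbit arc of time length `T`. -/
def IsArc (V : ℝ × ℝ → ℝ × ℝ) (T : ℝ) (u : ℝ → ℝ × ℝ) : Prop :=
  ∀ s ∈ Icc (0 : ℝ) 1, HasDerivAt u (T • V (u s)) s

theorem exists_arc_of_integralEq {f g : ℝ[X]} {a ε T : ℝ} {w : C(I, ℝ) × C(I, ℝ)}
    (h : integralEq f g (((a, ε), T), w) = 0) :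
    ∃ u : ℝ → ℝ × ℝ, IsArc (lienard f g ε) T u ∧ u 0 = (a, 0) ∧ ∀ s : I, u s = (w.1 s, w.2 s) := by
  have h1 : w.1 - a • (1 : C(I, ℝ)) - T • primitive w.2 = 0 := congrArg Prod.fst h
  have h2 : w.2 + T • primitive (aeval w.1 g + ε • (aeval w.1 f * w.2)) = 0 := congrArg Prod.snd h
  set z : C(I, ℝ) := aeval w.1 g + ε • (aeval w.1 f * w.2) with hz
  have hd : ∀ (v : C(I, ℝ)) (s : I), HasDerivAt (fun t : ℝ => ∫ r in (0 : ℝ)..t,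
      IccExtend zero_le_one v r) (v s) s := fun v s => by
    have hc : Continuous (IccExtend (zero_le_one (α := ℝ)) v) := v.continuous.Icc_extend'
    have := intervalIntegral.integral_hasDerivAt_right (hc.intervalIntegrable 0 s)
      (hc.stronglyMeasurableAtFilter _ _) hc.continuousAt
    rwa [IccExtend_val] at this
  have hx : ∀ s : I, w.1 s = a + T * ∫ r in (0 : ℝ)..s, IccExtend zero_le_one w.2 r := fun s => by
    have := congrArg (fun v : C(I, ℝ) => v s) h1
    simp [primitive_apply] at this
    linarith
  have hy : ∀ s : I, w.2 s = -(T * ∫ r in (0 : ℝ)..s, IccExtend zero_le_one z r) := fun s => by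
    have := congrArg (fun v : C(I, ℝ) => v s) h2
    simp only [ContinuousMap.add_apply, ContinuousMap.smul_apply, primitive_apply,
      ContinuousMap.zero_apply, smul_eq_mul] at this
    linarith
  set u : ℝ → ℝ × ℝ := fun s => (a + T * ∫ r in (0 : ℝ)..s, IccExtend zero_le_one w.2 r,
    -(T * ∫ r in (0 : ℝ)..s, IccExtend zero_le_one z r)) with hu
  have huw : ∀ s : I, u s = (w.1 s, w.2 s) := fun s => by rw [hx, hy]
  refine ⟨u, fun s hs => ?_, by simp [hu], huw⟩
  have e1 := ((hd w.2 ⟨s, hs⟩).const_mul T).const_add a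
  have e2 := ((hd z ⟨s, hs⟩).const_mul T).neg
  refine (e1.prodMk e2).congr_deriv ?_
  rw [huw ⟨s, hs⟩]
  ext
  · simp [lienard]
  · simp [lienard, hz]
    ring

/-- The energy lost along an arc, divided by `ε`. -/
noncomputable def dissipation (f : ℝ[X]) (T : ℝ) (w : C(I, ℝ) × C(I, ℝ)) : ℝ :=
  T * primitive (aeval w.1 f * (w.2 * w.2)) 1

theorem dissipation_eq {f : ℝ[X]} {T : ℝ} {w : C(I, ℝ) × C(I, ℝ)} {u : ℝ → ℝ × ℝ}
    (hu : ∀ s : I, u s = (w.1 s, w.2 s)) :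
    dissipation f T w = T * ∫ s in (0 : ℝ)..1, f.eval (u s).1 * (u s).2 ^ 2 := by
  rw [dissipation, primitive_apply]
  congr 1
  refine intervalIntegral.integral_congr fun s hs => ?_
  simp only [Icc.coe_one, uIcc_of_le (zero_le_one (α := ℝ))] at hs
  rw [hu ⟨s, hs⟩, IccExtend_of_mem _ _ hs]
  simp [pow_two]

theorem IsArc.energy {G f : ℝ[X]} {ε T : ℝ} {u : ℝ → ℝ × ℝ}
    (hu : IsArc (lienard f (derivative G) ε) T u) :
    (u 1).2 ^ 2 / 2 + G.eval (u 1).1 - ((u 0).2 ^ 2 / 2 + G.eval (u 0).1) =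
      -ε * (T * ∫ s in (0 : ℝ)..1, f.eval (u s).1 * (u s).2 ^ 2) := by
  have huc : ContinuousOn u (Icc 0 1) := fun t ht => (hu t ht).continuousAt.continuousWithinAt
  have h1 : ∀ s ∈ uIcc (0 : ℝ) 1, HasDerivAt (fun s => (u s).2 ^ 2 / 2 + G.eval (u s).1)
      (-ε * (T * (f.eval (u s).1 * (u s).2 ^ 2))) s := fun s hs => by
    rw [uIcc_of_le zero_le_one] at hs
    have e1 : HasDerivAt (fun s => (u s).1) _ s := (hu s hs).fst
    have e2 : HasDerivAt (fun s => (u s).2) _ s := (hu s hs).snd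
    have e3 := (G.hasDerivAt (u s).1).comp s e1
    refine (((e2.pow 2).div_const 2).add e3).congr_deriv ?_
    simp [lienard]
    ring
  rw [← intervalIntegral.integral_const_mul, ← intervalIntegral.integral_const_mul,
    intervalIntegral.integral_eq_sub_of_hasDerivAt h1]
  refine ContinuousOn.intervalIntegrable ?_
  rw [uIcc_of_le zero_le_one]
  have h2 : ContinuousOn (fun s => (u s).1) (Icc 0 1) := continuous_fst.comp_continuousOn huc
  have h3 : ContinuousOn (fun s => (u s).2) (Icc 0 1) := continuous_snd.comp_continuousOn huc
  have h4 := f.continuous.comp_continuousOn h2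
  simp only [Function.comp_def] at h4
  fun_prop

theorem IsArc.eqOn {f g : ℝ[X]} {ε T : ℝ} {u v : ℝ → ℝ × ℝ} (hu : IsArc (lienard f g ε) T u)
    (hv : IsArc (lienard f g ε) T v) (h0 : u 0 = v 0) : EqOn u v (Icc 0 1) :=
  eqOn_of_hasDerivAt (V := fun p => T • lienard f g ε p) ((contDiff_lienard f g ε).const_smul T)
    hu hv h0

theorem isArc_of_solution {V : ℝ × ℝ → ℝ × ℝ} {γ : ℝ → ℝ × ℝ}
    (h : ∀ t, HasDerivAt γ (V (γ t)) t) (t₀ T : ℝ) : IsArc V T fun s => γ (t₀ + T * s) :=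
  fun s _ => by
    have h1 : HasDerivAt (fun s : ℝ => t₀ + T * s) T s := by
      simpa using! ((hasDerivAt_id s).const_mul T).const_add t₀
    exact (h (t₀ + T * s)).scomp s h1

/-- The dissipation of a closed unperturbed arc is twice the Abelian integral. -/
theorem Oval.dissipation_eq_abelian {G f : ℝ[X]} {a b T : ℝ} {u : ℝ → ℝ × ℝ} (h : Oval G a b)
    (hu : IsArc (lienard f (derivative G) 0) T u) (hT : 0 < T) (h0 : u 0 = (a, 0))
    (h1 : u 1 = (a, 0)) (hne : ∀ s ∈ Icc (1 / 3 : ℝ) (2 / 3), (u s).1 ≠ a) :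
    T * ∫ s in (0 : ℝ)..1, f.eval (u s).1 * (u s).2 ^ 2 = 2 * abelian G f a b := by
  obtain ⟨x, y, T', hT', hx, hy, hx0, hy0, hxT, -, -, hxa, -, hab⟩ := h.exists_orbit
  have hsol : ∀ t, HasDerivAt (fun t => (x t, y t)) (lienard f (derivative G) 0 (x t, y t)) t :=
    fun t => ((hx t).prodMk (hy t)).congr_deriv (by simp [lienard])
  have heq : EqOn u (fun s => (x (0 + T * s), y (0 + T * s))) (Icc 0 1) :=
    hu.eqOn (isArc_of_solution hsol 0 T) (by simp [h0, hx0, hy0])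
  simp only [zero_add] at heq
  have hxT1 : x T = a := by
    have := heq (right_mem_Icc.2 zero_le_one)
    rw [h1] at this
    simpa using (congrArg Prod.fst this).symm
  obtain ⟨n, hn⟩ := hxa T hxT1
  have hnpos : 0 < n := by
    rw [hn] at hT
    exact_mod_cast pos_of_mul_pos_left hT hT'.le
  have hn1 : n = 1 := by
    by_contra hcon
    have hn2 : 2 ≤ n := by omega
    obtain ⟨j, hj1, hj2⟩ : ∃ j : ℤ, n ≤ 3 * j ∧ 3 * j ≤ 2 * n := ⟨(n + 2) / 3, by omega, by omega⟩
    have hn0 : (0 : ℝ) < n := by exact_mod_cast hnpos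
    have hj1' : (n : ℝ) ≤ 3 * j := by exact_mod_cast hj1
    have hj2' : 3 * (j : ℝ) ≤ 2 * n := by exact_mod_cast hj2
    have hs : (j : ℝ) / n ∈ Icc (1 / 3 : ℝ) (2 / 3) := by
      constructor
      · rw [div_le_div_iff₀ (by norm_num) hn0]; linarith
      · rw [div_le_div_iff₀ hn0 (by norm_num)]; linarith
    apply hne _ hs
    rw [heq ⟨by linarith [hs.1], by linarith [hs.2]⟩]
    change x (T * (j / n)) = a
    have hp : Function.Periodic x T' := hxT
    rw [hn, show (n : ℝ) * T' * (j / n) = 0 + j * T' by field_simp; ring, hp.int_mul j, hx0]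
  have hTT : T = T' := by rw [hn, hn1]; simp
  rw [← hab f, ← hTT]
  have h2 : ∫ s in (0 : ℝ)..1, f.eval (u s).1 * (u s).2 ^ 2 =
      ∫ s in (0 : ℝ)..1, (fun t => f.eval (x t) * y t ^ 2) (T * s) := by
    refine intervalIntegral.integral_congr fun s hs => ?_
    rw [uIcc_of_le zero_le_one] at hs
    simp only [heq hs]
  rw [h2, intervalIntegral.integral_comp_mul_left (fun t => f.eval (x t) * y t ^ 2) hT.ne']
  simp only [mul_zero, mul_one, smul_eq_mul]
  field_simp

theorem contDiff_dissipation (f : ℝ[X]) :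
    ContDiff ℝ 1 fun p : ℝ × (C(I, ℝ) × C(I, ℝ)) => dissipation f p.1 p.2 := by
  have hf := contDiff_aeval f
  have he : ContDiff ℝ 1 (ContinuousMap.evalCLM ℝ (1 : I) : C(I, ℝ) →L[ℝ] ℝ) :=
    ContinuousLinearMap.contDiff _
  have h1 : ContDiff ℝ 1 fun p : ℝ × (C(I, ℝ) × C(I, ℝ)) =>
      primitive (aeval p.2.1 f * (p.2.2 * p.2.2)) := by fun_prop
  exact contDiff_fst.mul (he.comp h1)

theorem exists_strictAntiOn_ball {G : ℝ[X]} {a : ℝ} (h : (derivative G).eval a < 0) :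
    ∃ ρ > 0, StrictAntiOn (fun x => G.eval x) (Metric.ball a ρ) := by
  have h1 : ∀ᶠ x in 𝓝 a, (derivative G).eval x < 0 :=
    (derivative G).continuous.continuousAt.eventually (gt_mem_nhds h)
  obtain ⟨ρ, hρ, hb⟩ := Metric.eventually_nhds_iff_ball.1 h1
  refine ⟨ρ, hρ, strictAntiOn_of_deriv_neg (convex_ball a ρ) G.continuous.continuousOn ?_⟩
  intro x hx
  rw [Metric.isOpen_ball.interior_eq] at hx
  simpa using hb x hx

/-- The return time of orbits issued from `(a, 0)` near an oval, with the corresponding arcs. -/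
theorem Oval.exists_return_time {G : ℝ[X]} {a b : ℝ} (h : Oval G a b) (f : ℝ[X]) :
    ∃ (x y : C(ℝ, ℝ)) (T : ℝ), 0 < T ∧ x T = a ∧ (∀ t, x t ∈ Icc a b) ∧
      (∀ t, y t ^ 2 / 2 + G.eval (x t) = G.eval a) ∧ (∀ t, x t = a → ∃ n : ℤ, t = n * T) ∧
      ∃ (τ : ℝ × ℝ → ℝ) (Q : ℝ × ℝ → C(I, ℝ) × C(I, ℝ)),
        (∃ τ' : ℝ × ℝ →L[ℝ] ℝ, HasStrictFDerivAt τ τ' (a, 0)) ∧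
        (∃ Q' : ℝ × ℝ →L[ℝ] (C(I, ℝ) × C(I, ℝ)), HasStrictFDerivAt Q Q' (a, 0)) ∧
        τ (a, 0) = T ∧ Q (a, 0) = (samplePath x T, samplePath y T) ∧
        ∀ᶠ e in 𝓝 ((a, 0) : ℝ × ℝ), (Q e).2 1 = 0 ∧
          integralEq f (derivative G) ((e, τ e), Q e) = 0 := by
  obtain ⟨x, y, T, hT, hx, hy, hx0, hy0, hxT, hyT, hmem, hxa, hen, -⟩ := h.exists_orbit
  have hxT' : x T = a := by rw [← hx0, ← hxT 0, zero_add]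
  have hyT' : y T = 0 := by rw [← hy0, ← hyT 0, zero_add]
  refine ⟨x, y, T, hT, hxT', hmem, hen, hxa, ?_⟩
  obtain ⟨S, ⟨S', hS'⟩, hS, hSref⟩ := exists_solution_map f (derivative G) hx hy hy0 T
  rw [hx0] at hS' hS hSref
  set ev : C(I, ℝ) →L[ℝ] ℝ := ContinuousMap.evalCLM ℝ (1 : I)
  set Y : (ℝ × ℝ) × ℝ → ℝ := fun q => (S q).2 1 with hY
  have hYd : HasStrictFDerivAt Y (ev ∘L (.snd ℝ C(I, ℝ) C(I, ℝ)) ∘L S') ((a, 0), T) :=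
    ev.hasStrictFDerivAt.comp _ (hasStrictFDerivAt_snd.comp _ hS')
  set Y' : (ℝ × ℝ) × ℝ →L[ℝ] ℝ := ev ∘L (.snd ℝ C(I, ℝ) C(I, ℝ)) ∘L S'
  have hY0 : Y ((a, 0), T) = 0 := by
    rw [hY]; simp only [hSref.self_of_nhds]; simpa using hyT'
  have hder : Y' (0, 1) = -(derivative G).eval a := by
    have h1 : HasDerivAt (fun t : ℝ => (((a, 0), t) : (ℝ × ℝ) × ℝ)) (0, 1) T :=
      (hasDerivAt_const T ((a, 0) : ℝ × ℝ)).prodMk (hasDerivAt_id T)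
    have h2 : HasDerivAt (fun t => Y ((a, 0), t)) (Y' (0, 1)) T :=
      hYd.hasFDerivAt.comp_hasDerivAt T h1
    have h3 : (fun t => Y ((a, 0), t)) =ᶠ[𝓝 T] y := by
      filter_upwards [hSref] with t ht
      simp [hY, ht]
    have h4 := (hy T).unique (h2.congr_of_eventuallyEq h3.symm)
    rw [← h4, hxT']
  have hc : -(derivative G).eval a ≠ 0 := by have := h.deriv_left; linarith
  have hinv : (Y' ∘L .inr ℝ (ℝ × ℝ) ℝ).IsInvertible := by
    refine ⟨ContinuousLinearEquiv.unitsEquivAut ℝ (Units.mk0 _ hc), ?_⟩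
    ext
    simp [hder]
  refine ⟨hYd.implicitFunctionOfProdDomain hinv,
    fun e => S (e, hYd.implicitFunctionOfProdDomain hinv e), ?_⟩
  have hτ' := hYd.hasStrictFDerivAt_implicitFunctionOfProdDomain hinv
  have hτ0 : hYd.implicitFunctionOfProdDomain hinv (a, 0) = T :=
    (hYd.eventually_apply_eq_iff_implicitFunctionOfProdDomain hinv).self_of_nhds.1 rfl
  have hτY := hYd.eventually_apply_implicitFunctionOfProdDomain hinv
  have hτt := hYd.tendsto_implicitFunctionOfProdDomain hinv
  set τ := hYd.implicitFunctionOfProdDomain hinv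
  have hid := (hasStrictFDerivAt_id (𝕜 := ℝ) ((a, 0) : ℝ × ℝ)).prodMk hτ'
  have ht : Tendsto (fun e => (e, τ e)) (𝓝 ((a, 0) : ℝ × ℝ)) (𝓝 (((a, 0), T) : (ℝ × ℝ) × ℝ)) :=
    tendsto_id.prodMk_nhds hτt
  refine ⟨⟨_, hτ'⟩, ⟨_, HasStrictFDerivAt.comp (f := fun e => (id e, τ e)) (g := S) (a, 0)
    (by simpa only [id, hτ0] using hS') hid⟩, hτ0, ?_, ?_⟩
  · change S ((a, 0), τ (a, 0)) = _
    rw [hτ0]; exact hSref.self_of_nhds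
  · filter_upwards [hτY, ht.eventually hS] with e h1 h2
    exact ⟨h1.trans hY0, h2⟩

/-- The first return map `P` and the dissipation `D` of the orbit arcs issued from `(e.1, 0)`, for
the parameter `ε = e.2`, near an oval of the unperturbed system. -/
theorem Oval.exists_return {G : ℝ[X]} {a b : ℝ} (h : Oval G a b) (f : ℝ[X]) :
    ∃ P D : ℝ × ℝ → ℝ, (∃ D' : ℝ × ℝ →L[ℝ] ℝ, HasStrictFDerivAt D D' (a, 0)) ∧
      Tendsto P (𝓝 (a, 0)) (𝓝 a) ∧
      (∀ U : Set (ℝ × ℝ), IsOpen U →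
        (∀ x y, x ∈ Icc a b → y ^ 2 / 2 + G.eval x = G.eval a → (x, y) ∈ U) →
        ∀ᶠ e in 𝓝 ((a, 0) : ℝ × ℝ), G.eval (P e) - G.eval e.1 = -e.2 * D e ∧
        ∃ T > 0, ∃ u, IsArc (lienard f (derivative G) e.2) T u ∧ u 0 = (e.1, 0) ∧
          u 1 = (P e, 0) ∧ ∀ s ∈ Icc (0 : ℝ) 1, u s ∈ U) ∧
      ∀ᶠ a' in 𝓝 a, ∀ b', Oval G a' b' → D (a', 0) = 2 * abelian G f a' b' := by
  obtain ⟨x, y, T, hT, hxT, hmem, hen, hxa, τ, Q, ⟨τ', hτ'⟩, ⟨Q', hQ'⟩, hτ0, hQ0, hQ⟩ :=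
    h.exists_return_time f
  set P : ℝ × ℝ → ℝ := fun e => (Q e).1 1 with hP
  set D : ℝ × ℝ → ℝ := fun e => dissipation f (τ e) (Q e) with hD
  have hPt : Tendsto P (𝓝 (a, 0)) (𝓝 a) := by
    have h1 : Continuous fun w : C(I, ℝ) × C(I, ℝ) => w.1 1 :=
      (continuous_eval_const (1 : I)).comp continuous_fst
    have h2 := h1.continuousAt.tendsto.comp hQ'.continuousAt.tendsto
    rw [hQ0] at h2
    simpa [hxT, Function.comp_def] using h2
  have hDd : ∃ D' : ℝ × ℝ →L[ℝ] ℝ, HasStrictFDerivAt D D' (a, 0) := by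
    have h1 := (contDiff_dissipation f).contDiffAt (x := (τ (a, 0), Q (a, 0)))
    exact ⟨_, (h1.hasStrictFDerivAt one_ne_zero).comp (a, 0) (hτ'.prodMk hQ')⟩
  have hclose : ∀ δ > 0, ∀ᶠ e in 𝓝 ((a, 0) : ℝ × ℝ), ∀ s : I,
      dist ((Q e).1 s, (Q e).2 s) (x (T * s), y (T * s)) < δ := fun δ hδ => by
    filter_upwards [Metric.tendsto_nhds.1 hQ'.continuousAt.tendsto δ hδ] with e he s
    rw [hQ0, Prod.dist_eq, max_lt_iff] at he
    rw [Prod.dist_eq, max_lt_iff]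
    exact ⟨(ContinuousMap.dist_apply_le_dist s).trans_lt he.1,
      (ContinuousMap.dist_apply_le_dist s).trans_lt he.2⟩
  have hUe : ∀ U : Set (ℝ × ℝ), IsOpen U →
      (∀ x y, x ∈ Icc a b → y ^ 2 / 2 + G.eval x = G.eval a → (x, y) ∈ U) →
      ∀ᶠ e in 𝓝 ((a, 0) : ℝ × ℝ), ∀ s : I, ((Q e).1 s, (Q e).2 s) ∈ U := by
    intro U hU hUo
    have hK : IsCompact (range fun s : I => (x (T * s), y (T * s))) :=
      isCompact_range (by fun_prop)
    obtain ⟨δ, hδ, hsub⟩ := hK.exists_thickening_subset_open hU (by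
      rintro _ ⟨s, rfl⟩; exact hUo _ _ (hmem _) (hen _))
    filter_upwards [hclose δ hδ] with e he s
    exact hsub (Metric.mem_thickening_iff.2 ⟨_, ⟨s, rfl⟩, he s⟩)
  have hτpos : ∀ᶠ e in 𝓝 ((a, 0) : ℝ × ℝ), 0 < τ e :=
    hτ'.continuousAt.eventually (lt_mem_nhds (by rw [hτ0]; exact hT))
  have hmain : ∀ᶠ e in 𝓝 ((a, 0) : ℝ × ℝ), G.eval (P e) - G.eval e.1 = -e.2 * D e ∧
      0 < τ e ∧ ∃ u, IsArc (lienard f (derivative G) e.2) (τ e) u ∧ u 0 = (e.1, 0) ∧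
        u 1 = (P e, 0) ∧ (∀ s : I, u s = ((Q e).1 s, (Q e).2 s)) := by
    filter_upwards [hQ, hτpos] with e he hpos
    obtain ⟨u, hu, hu0, huQ⟩ := exists_arc_of_integralEq he.2
    have hu1 : u 1 = (P e, 0) := by
      have := huQ 1
      rw [he.1] at this
      simpa using this
    refine ⟨?_, hpos, u, hu, hu0, hu1, huQ⟩
    have := hu.energy
    rw [hu1, hu0, ← dissipation_eq huQ] at this
    simpa using this
  refine ⟨P, D, hDd, hPt, fun U hU hUo => ?_, ?_⟩
  · filter_upwards [hmain, hUe U hU hUo] with e ⟨h1, h2, u, hu, hu0, hu1, huQ⟩ hUe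
    exact ⟨h1, τ e, h2, u, hu, hu0, hu1, fun s hs => by rw [huQ ⟨s, hs⟩]; exact hUe ⟨s, hs⟩⟩
  · obtain ⟨ρ, hρ, hanti⟩ := exists_strictAntiOn_ball h.deriv_left
    obtain ⟨κ, hκ, hxκ⟩ : ∃ κ > 0, ∀ s ∈ Icc (1 / 3 : ℝ) (2 / 3), a + 2 * κ ≤ x (T * s) := by
      obtain ⟨s, hs, hmin⟩ := isCompact_Icc.exists_isMinOn
        (nonempty_Icc.2 (by norm_num : (1 / 3 : ℝ) ≤ 2 / 3))
        (f := fun s => x (T * s)) (Continuous.continuousOn (by fun_prop))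
      have h1 : a < x (T * s) := (hmem _).1.lt_of_ne fun hcon => by
        obtain ⟨n, hn⟩ := hxa _ hcon.symm
        rw [mul_comm] at hn
        have h2 := mul_right_cancel₀ hT.ne' hn
        have h3 : (0 : ℝ) < n := by rw [← h2]; linarith [hs.1]
        have h4 : (n : ℝ) < 1 := by rw [← h2]; linarith [hs.2]
        have h5 : 0 < n := by exact_mod_cast h3
        have h6 : n < 1 := by exact_mod_cast h4
        omega
      refine ⟨(x (T * s) - a) / 2, by linarith, fun t ht => ?_⟩
      have := hmin ht
      rw [mem_ofPred_eq] at this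
      linarith
    have ht : Tendsto (fun a' : ℝ => (a', (0 : ℝ))) (𝓝 a) (𝓝 (a, 0)) :=
      Continuous.tendsto (by fun_prop) a
    filter_upwards [ht.eventually hmain, ht.eventually (hclose κ hκ), Metric.ball_mem_nhds a hρ,
      Metric.ball_mem_nhds a hκ, ht.eventually (hPt (Metric.ball_mem_nhds a hρ))]
      with a' ⟨h1, h2, u, hu, hu0, hu1, huQ⟩ hcl hbρ hbκ hPρ b' hab'
    have hPa : P (a', 0) = a' := hanti.injOn hPρ hbρ (by simpa [sub_eq_zero] using h1)
    rw [hPa] at hu1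
    rw [hD]
    simp only
    rw [dissipation_eq huQ]
    refine hab'.dissipation_eq_abelian hu h2 hu0 hu1 fun s hs hcon => ?_
    have h3 := hcl ⟨s, by linarith [hs.1], by linarith [hs.2]⟩
    rw [← huQ, Prod.dist_eq, max_lt_iff] at h3
    simp only [hcon, Real.dist_eq] at h3
    rw [Metric.mem_ball, Real.dist_eq] at hbκ
    have h4 := abs_lt.1 h3.1
    have h5 := abs_lt.1 hbκ
    have h6 := hxκ s hs
    linarith [h4.1, h5.2]

theorem eq_add_of_solution {V : ℝ × ℝ → ℝ × ℝ} (hV : ContDiff ℝ 1 V) {γ δ : ℝ → ℝ × ℝ}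
    (hγ : ∀ t, HasDerivAt γ (V (γ t)) t) (hδ : ∀ t, HasDerivAt δ (V (δ t)) t) {t₁ t₂ : ℝ}
    (h : γ t₁ = δ t₂) {s : ℝ} (hs : 0 ≤ s) : γ (t₁ + s) = δ (t₂ + s) := by
  have h1 : ∀ {φ : ℝ → ℝ × ℝ}, (∀ t, HasDerivAt φ (V (φ t)) t) → ∀ c,
      ∀ s, HasDerivAt (fun s => φ (c + s)) (V (φ (c + s))) s := fun hφ c s => by
    simpa using! (hφ (c + s)).comp_const_add c s
  exact eqOn_of_hasDerivAt hV (a := 0) (b := s) (fun s _ => h1 hγ t₁ s) (fun s _ => h1 hδ t₂ s)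
    (by simpa using h) (right_mem_Icc.2 hs)

theorem range_subset_of_solution {V : ℝ × ℝ → ℝ × ℝ} (hV : ContDiff ℝ 1 V) {γ δ : ℝ → ℝ × ℝ}
    (hγ : ∀ t, HasDerivAt γ (V (γ t)) t) (hδ : ∀ t, HasDerivAt δ (V (δ t)) t) {t₁ t₂ T : ℝ}
    (hT : 0 < T) (hper : Function.Periodic γ T) (h : γ t₁ = δ t₂) : range γ ⊆ range δ := by
  rintro _ ⟨t, rfl⟩
  obtain ⟨n, hn⟩ := exists_nat_ge ((t₁ - t) / T)
  rw [div_le_iff₀ hT] at hn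
  have h1 := eq_add_of_solution hV hγ hδ h (s := t + n * T - t₁) (by linarith)
  rw [add_sub_cancel, hper.nat_mul n] at h1
  exact ⟨_, h1.symm⟩

theorem _root_.IsPeriodicOrbit.eq_of_mem {V : ℝ × ℝ → ℝ × ℝ} (hV : ContDiff ℝ 1 V)
    {Γ Γ' : Set (ℝ × ℝ)}
    (h : IsPeriodicOrbit V Γ) (h' : IsPeriodicOrbit V Γ') {p : ℝ × ℝ} (hp : p ∈ Γ)
    (hp' : p ∈ Γ') : Γ = Γ' := by
  obtain ⟨γ, hγ, ⟨T, hT, hper⟩, -, rfl⟩ := h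
  obtain ⟨δ, hδ, ⟨T', hT', hper'⟩, -, rfl⟩ := h'
  obtain ⟨t₁, h1⟩ := hp
  obtain ⟨t₂, h2⟩ := hp'
  exact (range_subset_of_solution hV hγ hδ hT hper (h1.trans h2.symm)).antisymm
    (range_subset_of_solution hV hδ hγ hT' hper' (h2.trans h1.symm))

theorem _root_.IsPeriodicOrbit.isCompact {V : ℝ × ℝ → ℝ × ℝ} {Γ : Set (ℝ × ℝ)}
    (h : IsPeriodicOrbit V Γ) : IsCompact Γ := by
  obtain ⟨γ, hγ, ⟨T, hT, hper⟩, -, rfl⟩ := h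
  exact hper.compact_of_continuous hT.ne'
    (continuous_iff_continuousAt.2 fun t => (hγ t).continuousAt)

/-- A closed arc extends to a periodic orbit. -/
theorem IsArc.isPeriodicOrbit {V : ℝ × ℝ → ℝ × ℝ} {T : ℝ} {u : ℝ → ℝ × ℝ} (hu : IsArc V T u)
    (hT : 0 < T) (h01 : u 0 = u 1) (hV : V (u 0) ≠ 0) :
    ∃ Γ, IsPeriodicOrbit V Γ ∧ u 0 ∈ Γ ∧ Γ ⊆ u '' Icc 0 1 := by
  set v : ℝ → ℝ × ℝ := fun s => u (Int.fract s) with hv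
  have hvn : ∀ (n : ℤ) (s : ℝ), s ∈ Icc (n : ℝ) (n + 1) → v s = u (s - n) := fun n s hs => by
    rcases hs.2.lt_or_eq with h | h
    · rw [hv]
      simp only
      rw [Int.fract, Int.floor_eq_iff.2 ⟨hs.1, h⟩]
    · rw [hv]
      simp only
      rw [h]
      simp [h01]
  have hvI : ∀ (n : ℤ) (s : ℝ), s ∈ Icc (n : ℝ) (n + 1) →
      HasDerivWithinAt v (T • V (v s)) (Icc (n : ℝ) (n + 1)) s := fun n s hs => by
    have h1 := hu (s - n) ⟨by linarith [hs.1], by linarith [hs.2]⟩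
    have h2 : HasDerivAt (fun r => u (r - n)) (T • V (u (s - n))) s := by
      simpa using! h1.comp_sub_const s (n : ℝ)
    rw [hvn n s hs]
    exact h2.hasDerivWithinAt.congr (fun r hr => hvn n r hr) (hvn n s hs)
  have hvd : ∀ s, HasDerivAt v (T • V (v s)) s := fun s => by
    have h1 : HasDerivWithinAt v (T • V (v s)) (Ici s) s := by
      have hs : s ∈ Icc (⌊s⌋ : ℝ) (⌊s⌋ + 1) := ⟨Int.floor_le s, (Int.lt_floor_add_one s).le⟩
      refine (hvI ⌊s⌋ s hs).mono_of_mem_nhdsWithin ?_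
      filter_upwards [self_mem_nhdsWithin, mem_nhdsWithin_of_mem_nhds
        (Iio_mem_nhds (Int.lt_floor_add_one s))] with r hr hr'
      exact ⟨hs.1.trans hr, hr'.le⟩
    have h2 : HasDerivWithinAt v (T • V (v s)) (Iic s) s := by
      have hlt : ((⌈s⌉ - 1 : ℤ) : ℝ) < s := by
        push_cast
        linarith [Int.ceil_lt_add_one s]
      have hle : s ≤ ((⌈s⌉ - 1 : ℤ) : ℝ) + 1 := by
        push_cast
        linarith [Int.le_ceil s]
      refine (hvI (⌈s⌉ - 1) s ⟨hlt.le, hle⟩).mono_of_mem_nhdsWithin ?_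
      filter_upwards [self_mem_nhdsWithin, mem_nhdsWithin_of_mem_nhds (Ioi_mem_nhds hlt)]
        with r hr hr'
      exact ⟨hr'.le, le_trans hr hle⟩
    rw [← hasDerivWithinAt_univ, ← Iic_union_Ici (a := s)]
    exact h2.union h1
  set γ : ℝ → ℝ × ℝ := fun t => v (t / T) with hγ
  have hγd : ∀ t, HasDerivAt γ (V (γ t)) t := fun t => by
    have h1 : HasDerivAt (fun t : ℝ => t / T) T⁻¹ t := by
      simpa using (hasDerivAt_id t).div_const T
    refine ((hvd (t / T)).scomp t h1).congr_deriv ?_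
    rw [smul_smul, inv_mul_cancel₀ hT.ne', one_smul]
  have hγ0 : γ 0 = u 0 := by simp [hγ, hv]
  refine ⟨range γ, ⟨γ, hγd, ⟨T, hT, fun t => ?_⟩, ?_, rfl⟩, ⟨0, hγ0⟩, ?_⟩
  · simp only [hγ, hv, add_div, div_self hT.ne', Int.fract_add_one]
  · by_contra! hcon
    have h1 : γ = fun _ => γ 0 := funext fun t => hcon t 0
    have h2 := hγd 0
    rw [h1] at h2
    have h3 := h2.unique (hasDerivAt_const (0 : ℝ) (γ 0))
    exact hV (by rw [← hγ0]; exact h3)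
  · rintro _ ⟨t, rfl⟩
    exact ⟨_, ⟨Int.fract_nonneg _, (Int.fract_lt_one _).le⟩, rfl⟩

theorem Oval.eq_right {G : ℝ[X]} {a b b' : ℝ} (h : Oval G a b) (h' : Oval G a b') : b = b' := by
  rcases lt_trichotomy b b' with hlt | rfl | hlt
  · exact absurd h.eval_eq (h'.eval_lt b ⟨h.lt, hlt⟩).ne'
  · rfl
  · exact absurd h'.eval_eq (h.eval_lt b' ⟨h'.lt, hlt⟩).ne'

/-- A one-parameter family of ovals, with left turning points filling `[l₂, l₁]` and right turning
points filling `[r₁, r₂]`. -/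
structure Slot (G : ℝ[X]) where
  (l₂ l₁ r₁ r₂ : ℝ)
  left_lt : l₂ < l₁
  lt : l₁ < r₁
  right_lt : r₁ < r₂
  inner_eq : G.eval l₁ = G.eval r₁
  outer_eq : G.eval l₂ = G.eval r₂
  deriv_left : ∀ x ∈ Icc l₂ l₁, (derivative G).eval x < 0
  deriv_right : ∀ x ∈ Icc r₁ r₂, 0 < (derivative G).eval x
  eval_lt : ∀ x ∈ Ioo l₁ r₁, G.eval x < G.eval l₁

namespace Slot

variable {G : ℝ[X]} (s : Slot G)

theorem strictAntiOn : StrictAntiOn (fun x => G.eval x) (Icc s.l₂ s.l₁) :=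
  strictAntiOn_of_deriv_neg (convex_Icc _ _) G.continuous.continuousOn fun x hx => by
    simpa using s.deriv_left x (interior_subset hx)

theorem strictMonoOn : StrictMonoOn (fun x => G.eval x) (Icc s.r₁ s.r₂) :=
  strictMonoOn_of_deriv_pos (convex_Icc _ _) G.continuous.continuousOn fun x hx => by
    simpa using s.deriv_right x (interior_subset hx)

theorem exists_oval {a : ℝ} (ha : a ∈ Icc s.l₂ s.l₁) : ∃ b ∈ Icc s.r₁ s.r₂, Oval G a b := by
  have h1 : G.eval s.l₁ ≤ G.eval a :=
    s.strictAntiOn.antitoneOn ha (right_mem_Icc.2 s.left_lt.le) ha.2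
  have h2 : G.eval a ≤ G.eval s.l₂ :=
    s.strictAntiOn.antitoneOn (left_mem_Icc.2 s.left_lt.le) ha ha.1
  obtain ⟨b, hb, hab⟩ := intermediate_value_Icc s.right_lt.le
    (G.continuous.continuousOn (s := Icc s.r₁ s.r₂)) (s.inner_eq ▸ s.outer_eq ▸ ⟨h1, h2⟩ :
      G.eval a ∈ Icc (G.eval s.r₁) (G.eval s.r₂))
  refine ⟨b, hb, ⟨ha.2.trans_lt (s.lt.trans_le hb.1), hab.symm, fun x hx => ?_,
    s.deriv_left a ha, s.deriv_right b hb⟩⟩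
  rcases le_or_gt x s.l₁ with h | h
  · exact s.strictAntiOn ha ⟨ha.1.trans hx.1.le, h⟩ hx.1
  rcases lt_or_ge x s.r₁ with h' | h'
  · exact (s.eval_lt x ⟨h, h'⟩).trans_le h1
  · rw [← hab]
    exact s.strictMonoOn ⟨h', hx.2.le.trans hb.2⟩ hb hx.2

theorem oval_inner : Oval G s.l₁ s.r₁ :=
  ⟨s.lt, s.inner_eq, s.eval_lt, s.deriv_left _ (right_mem_Icc.2 s.left_lt.le),
    s.deriv_right _ (left_mem_Icc.2 s.right_lt.le)⟩

theorem oval_outer : Oval G s.l₂ s.r₂ := by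
  obtain ⟨b, hb, h⟩ := s.exists_oval (left_mem_Icc.2 s.left_lt.le)
  have : b = s.r₂ := s.strictMonoOn.injOn hb (right_mem_Icc.2 s.right_lt.le)
    (h.eval_eq.symm.trans s.outer_eq)
  rwa [this] at h

/-- The annulus swept by the ovals of the family. -/
def region : Set (ℝ × ℝ) :=
  {p | s.l₂ < p.1 ∧ p.1 < s.r₂ ∧ G.eval s.l₁ < p.2 ^ 2 / 2 + G.eval p.1 ∧
    p.2 ^ 2 / 2 + G.eval p.1 < G.eval s.l₂}

theorem isOpen_region : IsOpen s.region := by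
  have h1 : Continuous fun p : ℝ × ℝ => p.2 ^ 2 / 2 + G.eval p.1 := by fun_prop
  exact (isOpen_lt continuous_const continuous_fst).inter
    ((isOpen_lt continuous_fst continuous_const).inter
      ((isOpen_lt continuous_const h1).inter (isOpen_lt h1 continuous_const)))

theorem mem_region {a b x y : ℝ} (ha : a ∈ Ioo s.l₂ s.l₁) (h : Oval G a b) (hx : x ∈ Icc a b)
    (hy : y ^ 2 / 2 + G.eval x = G.eval a) : (x, y) ∈ s.region := by
  have h1 : G.eval s.l₁ < G.eval a :=
    s.strictAntiOn (Ioo_subset_Icc_self ha) (right_mem_Icc.2 s.left_lt.le) ha.2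
  have h2 : G.eval a < G.eval s.l₂ :=
    s.strictAntiOn (left_mem_Icc.2 s.left_lt.le) (Ioo_subset_Icc_self ha) ha.1
  obtain ⟨b', hb', h'⟩ := s.exists_oval (Ioo_subset_Icc_self ha)
  obtain rfl := h.eq_right h'
  have h3 : b < s.r₂ := hb'.2.lt_of_ne fun hcon => by
    rw [h.eval_eq, hcon, ← s.outer_eq] at h2
    exact h2.false
  exact ⟨ha.1.trans_le hx.1, hx.2.trans_lt h3, by rw [hy]; exact h1, by rw [hy]; exact h2⟩

/-- The leftmost point of a periodic orbit in the annulus lies in the left window. -/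
theorem exists_leftmost {f : ℝ[X]} {ε : ℝ} {Γ : Set (ℝ × ℝ)}
    (hΓ : IsPeriodicOrbit (lienard f (derivative G) ε) Γ) (hsub : Γ ⊆ s.region) :
    ∃ a ∈ Ioo s.l₂ s.l₁, (a, 0) ∈ Γ ∧ ∀ p ∈ Γ, a ≤ p.1 := by
  have hcpt := hΓ.isCompact
  obtain ⟨γ, hγ, -, -, rfl⟩ := hΓ
  obtain ⟨p, ⟨t₀, rfl⟩, hmin⟩ := hcpt.exists_isMinOn (range_nonempty γ) continuous_fst.continuousOn
  have hle : ∀ t, (γ t₀).1 ≤ (γ t).1 := fun t => hmin ⟨t, rfl⟩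
  have hx : ∀ t, HasDerivAt (fun t => (γ t).1) (γ t).2 t := fun t => (hγ t).fst
  have hy0 : (γ t₀).2 = 0 :=
    IsLocalMin.hasDerivAt_eq_zero (Eventually.of_forall hle) (hx t₀)
  have hmem := hsub ⟨t₀, rfl⟩
  have hγ0 : γ t₀ = ((γ t₀).1, 0) := Prod.ext rfl hy0
  refine ⟨(γ t₀).1, ⟨hmem.1, ?_⟩, hγ0 ▸ ⟨t₀, rfl⟩, by rintro _ ⟨t, rfl⟩; exact hle t⟩
  by_contra! hcon
  have hG := hmem.2.2.1
  rw [hy0] at hG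
  norm_num at hG
  have hr : s.r₁ < (γ t₀).1 := by
    by_contra! hle'
    rcases hcon.eq_or_lt with h | h
    · rw [h] at hG; exact hG.false
    rcases hle'.eq_or_lt with h' | h'
    · rw [h', s.inner_eq] at hG; exact hG.false
    · exact (hG.trans (s.eval_lt _ ⟨h, h'⟩)).false
  have hy : HasDerivAt (fun t => (γ t).2) (-(derivative G).eval (γ t₀).1) t₀ := by
    have h1 : HasDerivAt (fun t => (γ t).2) _ t₀ := (hγ t₀).snd
    refine h1.congr_deriv ?_
    simp [lienard, hy0]
  have hneg : -(derivative G).eval (γ t₀).1 < 0 := by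
    linarith [s.deriv_right (γ t₀).1 ⟨hr.le, hmem.2.1.le⟩]
  have hev : ∀ᶠ t in 𝓝[>] t₀, (γ t).2 < 0 := by
    have h1 := (hasDerivAt_iff_tendsto_slope.1 hy).eventually (gt_mem_nhds hneg)
    have h2 : 𝓝[>] t₀ ≤ 𝓝[≠] t₀ := nhdsWithin_mono _ fun t ht => ne_of_gt ht
    filter_upwards [h2 h1, self_mem_nhdsWithin] with t ht ht'
    rw [slope_def_field, hy0, sub_zero] at ht
    exact neg_of_div_neg_left ht (sub_pos.2 ht').le
  obtain ⟨t₁, ht₁, hIoo⟩ := (mem_nhdsGT_iff_exists_Ioo_subset).1 hev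
  have hanti : StrictAntiOn (fun t => (γ t).1) (Icc t₀ t₁) := by
    refine strictAntiOn_of_deriv_neg (convex_Icc _ _)
      (fun t _ => (hx t).continuousAt.continuousWithinAt) fun t ht => ?_
    rw [interior_Icc] at ht
    rw [(hx t).deriv]
    exact hIoo ht
  exact (hanti (left_mem_Icc.2 (le_of_lt ht₁)) (right_mem_Icc.2 (le_of_lt ht₁)) ht₁).not_ge (hle t₁)

end Slot

theorem _root_.IsPeriodicOrbit.mem_of_arc {f g : ℝ[X]} {ε T : ℝ} {Γ : Set (ℝ × ℝ)} {u : ℝ → ℝ × ℝ}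
    (hΓ : IsPeriodicOrbit (lienard f g ε) Γ) (hu : IsArc (lienard f g ε) T u) (h0 : u 0 ∈ Γ)
    {s : ℝ} (hs : s ∈ Icc (0 : ℝ) 1) : u s ∈ Γ := by
  obtain ⟨γ, hγ, -, -, rfl⟩ := hΓ
  obtain ⟨t, ht⟩ := h0
  rw [hu.eqOn (isArc_of_solution hγ t T) (by simp [ht]) hs]
  exact ⟨_, rfl⟩

/-- Persistence and uniqueness of a simple zero. -/
theorem exists_persistent_zero {D : ℝ × ℝ → ℝ} {D' : ℝ × ℝ →L[ℝ] ℝ} {a₀ c : ℝ}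
    (hD : HasStrictFDerivAt D D' (a₀, 0)) (h0 : D (a₀, 0) = 0) (hc : D' (1, 0) = c) (hc0 : c ≠ 0) :
    ∃ ρ₀ > 0, ∀ ρ > 0, ρ ≤ ρ₀ → ∀ᶠ ε in 𝓝 (0 : ℝ), ∃ a, |a - a₀| < ρ ∧ D (a, ε) = 0 ∧
      ∀ x, |x - a₀| ≤ ρ₀ → |D (x, ε) - c * (x - a)| ≤ |c| / 2 * |x - a| := by
  have hc' : 0 < |c| / 2 := by positivity
  have h1 := hD.isLittleO.def hc'
  rw [nhds_prod_eq] at h1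
  obtain ⟨r, hr, hb⟩ := Metric.eventually_nhds_iff_ball.1 (nhds_prod_eq (x := ((a₀, 0) : ℝ × ℝ))
    (y := ((a₀, 0) : ℝ × ℝ)) ▸ h1)
  have hest : ∀ ε x z, |ε| < r → |x - a₀| ≤ r / 2 → |z - a₀| ≤ r / 2 →
      |D (x, ε) - D (z, ε) - c * (x - z)| ≤ |c| / 2 * |x - z| := fun ε x z hε hx hz => by
    have h2 := hb ((x, ε), (z, ε)) (by
      simp only [Metric.mem_ball, Prod.dist_eq, Real.dist_eq, max_lt_iff, sub_zero]
      refine ⟨⟨?_, hε⟩, ?_, hε⟩ <;> linarith)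
    have h3 : ((x, ε) : ℝ × ℝ) - (z, ε) = (x - z) • ((1 : ℝ), (0 : ℝ)) := by
      ext <;> simp
    simp only [h3, map_smul, hc, norm_smul, smul_eq_mul, Real.norm_eq_abs, Prod.norm_def] at h2
    simpa [mul_comm] using h2
  refine ⟨r / 2, by positivity, fun ρ hρ hρr => ?_⟩
  have hcont : ∀ᶠ ε in 𝓝 (0 : ℝ), |D (a₀, ε)| < |c| / 2 * ρ := by
    have h2 : Tendsto (fun ε : ℝ => D (a₀, ε)) (𝓝 0) (𝓝 0) := by
      have h3 : Tendsto (fun ε : ℝ => (a₀, ε)) (𝓝 0) (𝓝 (a₀, 0)) :=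
        Continuous.tendsto (by fun_prop) 0
      simpa [h0, Function.comp_def] using hD.continuousAt.tendsto.comp h3
    have := Metric.tendsto_nhds.1 h2 (|c| / 2 * ρ) (by positivity)
    simpa [Real.dist_eq] using this
  filter_upwards [hcont, Metric.ball_mem_nhds 0 hr] with ε hε hεr
  rw [Metric.mem_ball, Real.dist_eq, sub_zero] at hεr
  have hin : ∀ x ∈ Icc (a₀ - ρ) (a₀ + ρ), |x - a₀| ≤ r / 2 := fun x hx => by
    rw [abs_le]; constructor <;> linarith [hx.1, hx.2]
  have hcontOn : ContinuousOn (fun x => c * D (x, ε)) (Icc (a₀ - ρ) (a₀ + ρ)) := by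
    refine ContinuousOn.const_mul ?_ c
    refine (LipschitzOnWith.of_dist_le_mul (K := (3 * |c| / 2).toNNReal)
      fun x hx z hz => ?_).continuousOn
    rw [Real.coe_toNNReal _ (by positivity), Real.dist_eq, Real.dist_eq]
    have h2 := hest ε x z hεr (hin x hx) (hin z hz)
    have h3 := abs_sub_abs_le_abs_sub (D (x, ε) - D (z, ε)) (c * (x - z))
    rw [abs_mul] at h3
    linarith
  have hcc : |c| * |c| = c * c := abs_mul_abs_self c
  have hmul : ∀ z, |z| ≤ |c| / 2 * ρ → |c * z| ≤ c * c / 2 * ρ := fun z hz => by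
    rw [abs_mul, ← hcc]
    have := mul_le_mul_of_nonneg_left hz (abs_nonneg c)
    linarith
  have hlt : |c * D (a₀, ε)| < c * c / 2 * ρ := by
    rw [abs_mul, ← hcc]
    have := mul_lt_mul_of_pos_left hε (abs_pos.2 hc0)
    linarith
  have hleft : c * D (a₀ - ρ, ε) < 0 := by
    have h2 := hest ε (a₀ - ρ) a₀ hεr (hin _ ⟨le_rfl, by linarith⟩)
      (by simpa using (half_pos hr).le)
    rw [sub_sub_cancel_left, abs_neg, abs_of_pos hρ] at h2
    have h3 := (abs_le.1 (hmul _ h2)).2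
    have h4 := (abs_lt.1 hlt).2
    nlinarith
  have hright : 0 < c * D (a₀ + ρ, ε) := by
    have h2 := hest ε (a₀ + ρ) a₀ hεr (hin _ ⟨by linarith, le_rfl⟩)
      (by simpa using (half_pos hr).le)
    rw [add_sub_cancel_left, abs_of_pos hρ] at h2
    have h3 := (abs_le.1 (hmul _ h2)).1
    have h4 := (abs_lt.1 hlt).1
    nlinarith
  obtain ⟨a, ha, hDa⟩ := intermediate_value_Ioo (by linarith) hcontOn ⟨hleft, hright⟩
  have hDa' : D (a, ε) = 0 := (mul_eq_zero.1 hDa).resolve_left hc0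
  refine ⟨a, abs_lt.2 ⟨by linarith [ha.1], by linarith [ha.2]⟩, hDa', fun x hx => ?_⟩
  simpa [hDa'] using hest ε x a hεr hx (hin a (Ioo_subset_Icc_self ha))

/-- A first return displacement `δ` driven by the dissipation `d ≈ c h` expands or contracts `h`. -/
theorem sq_lt_sq_of_displacement {ε d h δ c K : ℝ} (hε : 0 < ε) (hc : c ≠ 0) (hK : 0 < K)
    (hδ : K * δ ^ 2 ≤ ε * d * δ) (hδ0 : δ = 0 → d = 0) (hd : |d - c * h| ≤ |c| / 2 * |h|)
    (hsmall : ε * |c| ≤ K) (hh : h ≠ 0) :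
    (0 < c → h ^ 2 < (h + δ) ^ 2) ∧ (c < 0 → (h + δ) ^ 2 < h ^ 2) := by
  have hcc : 0 < |c| := abs_pos.2 hc
  have hhh : 0 < |h| := abs_pos.2 hh
  have hdh : |c * (d * h) - (c * h) ^ 2| ≤ (c * h) ^ 2 / 2 := by
    have h1 : c * (d * h) - (c * h) ^ 2 = (c * h) * (d - c * h) := by ring
    rw [h1, abs_mul, abs_mul]
    calc |c| * |h| * |d - c * h| ≤ |c| * |h| * (|c| / 2 * |h|) := by gcongr
      _ = (|c| * |h|) ^ 2 / 2 := by ring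
      _ = (c * h) ^ 2 / 2 := by rw [← abs_mul, sq_abs]
  have hch : 0 < (c * h) ^ 2 := by positivity
  have hcdh : 0 < c * (d * h) := by linarith [(abs_le.1 hdh).1]
  have hd0 : d ≠ 0 := by rintro rfl; simp at hcdh
  have hδne : δ ≠ 0 := fun h0 => hd0 (hδ0 h0)
  have hdδ : 0 < d * δ := by
    have : 0 < K * δ ^ 2 := by positivity
    have h2 : 0 < ε * (d * δ) := by linarith
    exact pos_of_mul_pos_right h2 hε.le
  have hcδh : 0 < c * (δ * h) := by
    have h1 := mul_pos hcdh hdδ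
    have h2 : c * (d * h) * (d * δ) = d ^ 2 * (c * (δ * h)) := by ring
    rw [h2] at h1
    exact pos_of_mul_pos_right h1 (by positivity)
  constructor
  · intro hcpos
    have := pos_of_mul_pos_right hcδh hcpos.le
    nlinarith [sq_nonneg δ]
  · intro hcneg
    have hδh : δ * h < 0 := by
      by_contra! hcon
      nlinarith
    have hδabs : 0 < |δ| := abs_pos.2 hδne
    have hdabs : |d| ≤ 3 / 2 * (|c| * |h|) := by
      have := abs_sub_abs_le_abs_sub d (c * h)
      rw [abs_mul] at this
      linarith
    have h1 : K * |δ| ≤ ε * |d| := by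
      have h2 : K * |δ| * |δ| ≤ ε * |d| * |δ| := by
        calc K * |δ| * |δ| = K * δ ^ 2 := by rw [mul_assoc, abs_mul_abs_self]; ring
          _ ≤ ε * d * δ := hδ
          _ ≤ ε * |d| * |δ| := by
            rw [mul_assoc, mul_assoc, ← abs_mul]
            exact mul_le_mul_of_nonneg_left (le_abs_self _) hε.le
      exact le_of_mul_le_mul_right h2 hδabs
    have h2 : K * |δ| < K * (2 * |h|) := by
      calc K * |δ| ≤ ε * |d| := h1
        _ ≤ ε * (3 / 2 * (|c| * |h|)) := by gcongr
        _ = (ε * |c|) * (3 / 2 * |h|) := by ring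
        _ ≤ K * (3 / 2 * |h|) := by gcongr
        _ < K * (2 * |h|) := by gcongr; norm_num
    have h3 : |δ| < 2 * |h| := lt_of_mul_lt_mul_left h2 hK.le
    have h4 : δ ^ 2 < -(2 * (δ * h)) := by
      have h5 : |δ| * |δ| < |δ| * (2 * |h|) := by gcongr
      rw [abs_mul_abs_self] at h5
      have h6 : |δ| * (2 * |h|) = -(2 * (δ * h)) := by
        rw [← mul_neg, ← abs_of_neg hδh, abs_mul]; ring
      nlinarith
    nlinarith

theorem Slot.exists_limitCycle {G : ℝ[X]} (s : Slot G) (f : ℝ[X]) {M : ℝ → ℝ}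
    (hM : ∀ a ∈ Ioo s.l₂ s.l₁, ∀ b, Oval G a b → M a = abelian G f a b) {a₀ : ℝ}
    (ha₀ : a₀ ∈ Ioo s.l₂ s.l₁) (h0 : M a₀ = 0) {m : ℝ} (hm : HasDerivAt M m a₀) (hm0 : m ≠ 0) :
    ∃ ε₀ > 0, ∀ ε, 0 < ε → ε ≤ ε₀ →
      ∃ Γ, IsLimitCycle (lienard f (derivative G) ε) Γ ∧ Γ ⊆ s.region := by
  obtain ⟨b₀, hb₀, hoval⟩ := s.exists_oval (Ioo_subset_Icc_self ha₀)
  obtain ⟨P, D, ⟨D', hD'⟩, hP, harc, hDM⟩ := hoval.exists_return f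
  have hDM' : (fun a => D (a, 0)) =ᶠ[𝓝 a₀] fun a => 2 * M a := by
    filter_upwards [hDM, Ioo_mem_nhds ha₀.1 ha₀.2] with a h1 h2
    obtain ⟨b, -, hb⟩ := s.exists_oval (Ioo_subset_Icc_self h2)
    rw [h1 b hb, hM a h2 b hb]
  have hD0 : D (a₀, 0) = 0 := by
    have h1 : D (a₀, 0) = 2 * M a₀ := hDM'.self_of_nhds
    rw [h1, h0, mul_zero]
  set c : ℝ := 2 * m with hc
  have hc0 : c ≠ 0 := mul_ne_zero two_ne_zero hm0
  have hDc : D' (1, 0) = c := by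
    have h1 : HasDerivAt (fun a : ℝ => (a, (0 : ℝ))) (1, 0) a₀ :=
      (hasDerivAt_id a₀).prodMk (hasDerivAt_const a₀ (0 : ℝ))
    have h2 : HasDerivAt (fun a => D (a, 0)) (D' (1, 0)) a₀ :=
      hD'.hasFDerivAt.comp_hasDerivAt a₀ h1
    exact h2.unique ((hm.const_mul 2).congr_of_eventuallyEq hDM')
  obtain ⟨ρ₀, hρ₀, hzero⟩ := exists_persistent_zero hD' hD0 hDc hc0
  -- a ball around `a₀` on which `G` decreases at a definite rate
  set K : ℝ := -(derivative G).eval a₀ / 2 with hK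
  have hg0 := s.deriv_left a₀ (Ioo_subset_Icc_self ha₀)
  have hKpos : 0 < K := by rw [hK]; linarith
  obtain ⟨ρ₁, hρ₁, hball⟩ := Metric.eventually_nhds_iff_ball.1
    (((derivative G).continuous.continuousAt.eventually (gt_mem_nhds
      (show (derivative G).eval a₀ < -K by rw [hK]; linarith))).and (Ioo_mem_nhds ha₀.1 ha₀.2))
  have hslope : ∀ x ∈ Metric.ball a₀ ρ₁, ∀ y ∈ Metric.ball a₀ ρ₁,
      K * (y - x) ^ 2 ≤ -(G.eval y - G.eval x) * (y - x) := by
    have h1 : ∀ x ∈ Metric.ball a₀ ρ₁, ∀ y ∈ Metric.ball a₀ ρ₁, x ≤ y →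
        G.eval y - G.eval x ≤ -K * (y - x) := by
      refine (convex_ball a₀ ρ₁).image_sub_le_mul_sub_of_deriv_le G.continuous.continuousOn
        G.differentiable.differentiableOn fun x hx => ?_
      rw [Metric.isOpen_ball.interior_eq] at hx
      simpa using (hball x hx).1.le
    intro x hx y hy
    rcases le_total x y with hxy | hxy
    · nlinarith [h1 x hx y hy hxy]
    · nlinarith [h1 y hy x hx hxy]
  have hev : ∀ᶠ e in 𝓝 ((a₀, 0) : ℝ × ℝ), P e ∈ Metric.ball a₀ ρ₁ ∧
      G.eval (P e) - G.eval e.1 = -e.2 * D e ∧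
        ∃ T > 0, ∃ u, IsArc (lienard f (derivative G) e.2) T u ∧ u 0 = (e.1, 0) ∧
          u 1 = (P e, 0) ∧ ∀ t ∈ Icc (0 : ℝ) 1, u t ∈ s.region :=
    (hP.eventually_mem (Metric.ball_mem_nhds a₀ hρ₁)).and (harc s.region s.isOpen_region
      fun x y hx hy => s.mem_region ha₀ hoval hx hy)
  obtain ⟨r₁, hr₁, hev₁⟩ := Metric.eventually_nhds_iff_ball.1 hev
  obtain ⟨ρ, hρ, hρm⟩ := exists_between (lt_min (lt_min hρ₀ hρ₁) hr₁)
  simp only [lt_min_iff] at hρm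
  obtain ⟨⟨hρρ₀, hρρ₁⟩, hρr⟩ := hρm
  have hbIcc : ∀ x, |x - a₀| ≤ ρ → x ∈ Metric.ball a₀ ρ₁ := fun x hx => by
    rw [Metric.mem_ball, Real.dist_eq]; linarith
  have hIcc : ∀ x, |x - a₀| ≤ ρ → x ∈ Icc s.l₂ s.l₁ := fun x hx =>
    Ioo_subset_Icc_self (hball x (hbIcc x hx)).2
  have hplus : |a₀ + ρ - a₀| ≤ ρ := by rw [add_sub_cancel_left, abs_of_pos hρ]
  have hminus : |a₀ - ρ - a₀| ≤ ρ := by rw [sub_sub_cancel_left, abs_neg, abs_of_pos hρ]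
  set U : Set (ℝ × ℝ) := s.region ∩ {p | G.eval (a₀ + ρ) < p.2 ^ 2 / 2 + G.eval p.1 ∧
    p.2 ^ 2 / 2 + G.eval p.1 < G.eval (a₀ - ρ)} with hUdef
  have hUopen : IsOpen U := by
    have h1 : Continuous fun p : ℝ × ℝ => p.2 ^ 2 / 2 + G.eval p.1 := by fun_prop
    exact s.isOpen_region.inter ((isOpen_lt continuous_const h1).inter
      (isOpen_lt h1 continuous_const))
  have hUmem : ∀ x, x ∈ Icc s.l₂ s.l₁ → (x, (0 : ℝ)) ∈ U → |x - a₀| ≤ ρ := fun x hx hxU => by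
    have h1 := hxU.2.1
    have h2 := hxU.2.2
    norm_num at h1 h2
    have h3 := (s.strictAntiOn.lt_iff_gt (hIcc _ hplus) hx).1 h1
    have h4 := (s.strictAntiOn.lt_iff_gt hx (hIcc _ hminus)).1 h2
    rw [abs_le]
    constructor <;> linarith
  have hev2 := harc U hUopen fun x y hx hy => ⟨s.mem_region ha₀ hoval hx hy, by
    simp only [mem_ofPred_eq, hy]
    exact ⟨s.strictAntiOn (hIcc _ (by simpa using hρ.le)) (hIcc _ hplus) (by linarith),
      s.strictAntiOn (hIcc _ hminus) (hIcc _ (by simpa using hρ.le)) (by linarith)⟩⟩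
  obtain ⟨r₂, hr₂, hev₂⟩ := Metric.eventually_nhds_iff_ball.1 hev2
  obtain ⟨ε₁, hε₁, hzero'⟩ := Metric.eventually_nhds_iff_ball.1
    (hzero (min ρ r₂) (lt_min hρ hr₂) ((min_le_left _ _).trans hρρ₀.le))
  obtain ⟨ε₀, hε₀, hε₀m⟩ := exists_between
    (lt_min (lt_min hε₁ hr₁) (lt_min hr₂ (div_pos hKpos (abs_pos.2 hc0))))
  simp only [lt_min_iff] at hε₀m
  obtain ⟨⟨hεε₁, hεr₁⟩, hεr₂, hεK⟩ := hε₀m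
  rw [lt_div_iff₀ (abs_pos.2 hc0)] at hεK
  refine ⟨ε₀, hε₀, fun ε hε hεle => ?_⟩
  have hεabs : |ε| ≤ ε₀ := by rwa [abs_of_pos hε]
  obtain ⟨a, ha, hDa, hest⟩ := hzero' ε (by
    rw [Metric.mem_ball, Real.dist_eq, sub_zero]; linarith)
  have haρ : |a - a₀| ≤ ρ := (ha.trans_le (min_le_left _ _)).le
  have hmem₁ : ∀ x, |x - a₀| ≤ ρ → ((x, ε) : ℝ × ℝ) ∈ Metric.ball ((a₀, 0) : ℝ × ℝ) r₁ :=
    fun x hx => by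
      simp only [Metric.mem_ball, Prod.dist_eq, Real.dist_eq, max_lt_iff, sub_zero]
      constructor <;> linarith
  have hmem₂ : ((a, ε) : ℝ × ℝ) ∈ Metric.ball ((a₀, 0) : ℝ × ℝ) r₂ := by
    simp only [Metric.mem_ball, Prod.dist_eq, Real.dist_eq, max_lt_iff, sub_zero]
    exact ⟨ha.trans_le (min_le_right _ _), by linarith⟩
  have hgain : ∀ x, |x - a₀| ≤ ρ → x - a ≠ 0 →
      (0 < c → (x - a) ^ 2 < (P (x, ε) - a) ^ 2) ∧ (c < 0 → (P (x, ε) - a) ^ 2 < (x - a) ^ 2) := by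
    intro x hx hxa
    obtain ⟨h1, h2, -⟩ := hev₁ _ (hmem₁ x hx)
    simp only at h2
    have h3 := hslope x (hbIcc x hx) _ h1
    rw [h2] at h3
    have h4 := sq_lt_sq_of_displacement (δ := P (x, ε) - x) hε hc0 hKpos (by linarith)
      (fun h => by
        rw [sub_eq_zero] at h
        rw [h, sub_self, eq_comm, neg_mul, neg_eq_zero] at h2
        exact (mul_eq_zero.1 h2).resolve_left hε.ne')
      (hest x (hx.trans hρρ₀.le)) (by nlinarith [abs_pos.2 hc0]) hxa
    have h5 : x - a + (P (x, ε) - x) = P (x, ε) - a := by ring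
    rwa [h5] at h4
  have hPa : P (a, ε) = a := by
    obtain ⟨h1, h2, -⟩ := hev₁ _ (hmem₁ a haρ)
    simp only [hDa, mul_zero, sub_eq_zero] at h2
    exact s.strictAntiOn.injOn (Ioo_subset_Icc_self (hball _ h1).2) (hIcc a haρ) h2
  obtain ⟨-, T, hT, u, hu, hu0, hu1, huU⟩ := hev₂ _ hmem₂
  simp only [hPa] at hu hu0 hu1
  obtain ⟨Γ, hΓ, hΓ0, hΓu⟩ := hu.isPeriodicOrbit hT (hu0.trans hu1.symm) (by
    rw [hu0]
    intro hcon
    have := congrArg Prod.snd hcon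
    simp only [lienard, mul_zero, sub_zero, Prod.snd_zero, neg_eq_zero] at this
    exact (s.deriv_left a (hIcc a haρ)).ne this)
  have hΓU : Γ ⊆ U := fun p hp => by
    obtain ⟨t, ht, rfl⟩ := hΓu hp
    exact huU t ht
  refine ⟨Γ, ⟨hΓ, U, hUopen, hΓU, fun Γ' hΓ' hsub => ?_⟩, hΓU.trans inter_subset_left⟩
  set A : Set ℝ := Icc (a₀ - ρ) (a₀ + ρ) ∩ (fun x => (x, (0 : ℝ))) ⁻¹' Γ' with hA
  have hAcpt : IsCompact A := isCompact_Icc.inter_right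
    (hΓ'.isCompact.isClosed.preimage (by fun_prop))
  have hAiff : ∀ x, x ∈ A ↔ |x - a₀| ≤ ρ ∧ (x, (0 : ℝ)) ∈ Γ' := fun x => by
    rw [hA, mem_inter_iff, mem_preimage, mem_Icc, abs_le]
    constructor <;> rintro ⟨⟨h1, h2⟩, h3⟩ <;> exact ⟨⟨by linarith, by linarith⟩, h3⟩
  have hAne : A.Nonempty := by
    obtain ⟨x, hx, hxΓ, -⟩ := s.exists_leftmost hΓ' (hsub.trans inter_subset_left)
    exact ⟨x, (hAiff x).2 ⟨hUmem x (Ioo_subset_Icc_self hx) (hsub hxΓ), hxΓ⟩⟩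
  have hPA : ∀ x ∈ A, P (x, ε) ∈ A := fun x hx => by
    obtain ⟨hx1, hx2⟩ := (hAiff x).1 hx
    obtain ⟨h1, -, T', hT', v, hv, hv0, hv1, -⟩ := hev₁ _ (hmem₁ x hx1)
    have h2 : (P (x, ε), (0 : ℝ)) ∈ Γ' := by
      rw [← hv1]
      exact hΓ'.mem_of_arc hv (by rw [hv0]; exact hx2) (right_mem_Icc.2 zero_le_one)
    exact (hAiff _).2 ⟨hUmem _ (Ioo_subset_Icc_self (hball _ h1).2) (hsub h2), h2⟩
  have haA : a ∈ A := by
    have hcont : ContinuousOn (fun x : ℝ => (x - a) ^ 2) A := Continuous.continuousOn (by fun_prop)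
    rcases hc0.lt_or_gt with hcs | hcs
    · obtain ⟨x, hx, hmin⟩ := hAcpt.exists_isMinOn hAne hcont
      by_cases hxa : x - a = 0
      · rwa [sub_eq_zero.1 hxa] at hx
      · exact absurd (hmin (hPA x hx)) (not_le.2 ((hgain x ((hAiff x).1 hx).1 hxa).2 hcs))
    · obtain ⟨x, hx, hmax⟩ := hAcpt.exists_isMaxOn hAne hcont
      by_cases hxa : x - a = 0
      · rwa [sub_eq_zero.1 hxa] at hx
      · exact absurd (hmax (hPA x hx)) (not_le.2 ((hgain x ((hAiff x).1 hx).1 hxa).1 hcs))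
  rw [hu0] at hΓ0
  exact hΓ'.eq_of_mem (contDiff_lienard _ _ _) hΓ ((hAiff a).1 haA).2 hΓ0

theorem continuous_abelian_integrand (G f : ℝ[X]) (c : ℝ) :
    Continuous fun x => f.eval x * √(2 * (c - G.eval x)) := by fun_prop

theorem abelian_add (G f₁ f₂ : ℝ[X]) (a b : ℝ) :
    abelian G (f₁ + f₂) a b = abelian G f₁ a b + abelian G f₂ a b := by
  unfold abelian
  rw [← intervalIntegral.integral_add
    ((continuous_abelian_integrand G f₁ _).intervalIntegrable _ _)
    ((continuous_abelian_integrand G f₂ _).intervalIntegrable _ _)]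
  simp only [eval_add, add_mul]

theorem abelian_C_mul (G f : ℝ[X]) (c a b : ℝ) :
    abelian G (C c * f) a b = c * abelian G f a b := by
  unfold abelian
  rw [← intervalIntegral.integral_const_mul]
  simp only [eval_mul, eval_C, mul_assoc]

theorem Oval.abelian_one_pos {G : ℝ[X]} {a b : ℝ} (h : Oval G a b) : 0 < abelian G 1 a b := by
  refine intervalIntegral.intervalIntegral_pos_of_pos_on
    ((continuous_abelian_integrand G 1 _).intervalIntegrable _ _) (fun x hx => ?_) h.lt
  have := h.eval_lt x hx
  simp only [eval_one, one_mul]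
  exact Real.sqrt_pos.2 (by linarith)

/-- The Abelian integral over the oval with left turning point `a`. -/
noncomputable def melnikov (G f : ℝ[X]) (a : ℝ) : ℝ :=
  abelian G f a (Classical.epsilon (Oval G a))

theorem Oval.melnikov_eq {G : ℝ[X]} {a b : ℝ} (h : Oval G a b) (f : ℝ[X]) :
    melnikov G f a = abelian G f a b := by
  rw [melnikov, (Classical.epsilon_spec ⟨b, h⟩ : Oval G a _).eq_right h]

theorem Slot.differentiableOn_melnikov {G : ℝ[X]} (s : Slot G) (f : ℝ[X]) :
    DifferentiableOn ℝ (melnikov G f) (Icc s.l₂ s.l₁) := by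
  intro a ha
  obtain ⟨b, hb, hoval⟩ := s.exists_oval ha
  obtain ⟨P, D, ⟨D', hD'⟩, -, -, hDM⟩ := hoval.exists_return f
  have h1 : HasDerivAt (fun a : ℝ => (a, (0 : ℝ))) (1, 0) a :=
    (hasDerivAt_id a).prodMk (hasDerivAt_const a (0 : ℝ))
  have h2 : HasDerivAt (fun a => D (a, 0)) (D' (1, 0)) a :=
    hD'.hasFDerivAt.comp_hasDerivAt a h1
  have h3 : (melnikov G f) =ᶠ[𝓝[Icc s.l₂ s.l₁] a] fun a => D (a, 0) / 2 := by
    filter_upwards [hDM.filter_mono nhdsWithin_le_nhds, self_mem_nhdsWithin] with x hx hxm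
    obtain ⟨y, -, hy⟩ := s.exists_oval hxm
    rw [hx y hy, hy.melnikov_eq]
    ring
  exact ((h2.div_const 2).differentiableAt.differentiableWithinAt).congr_of_eventuallyEq h3
    (h3.self_of_nhdsWithin ha)

/-- For a generic small shift `c`, the weight `f + c` has a simple zero in every slot where the
Abelian integral of `f` changes sign, hence a limit cycle there. -/
theorem exists_generic_shift {G : ℝ[X]} {ι : Type*} [Finite ι] (s : ι → Slot G) (f : ℝ[X])
    (hs : ∀ i, abelian G f (s i).l₁ (s i).r₁ * abelian G f (s i).l₂ (s i).r₂ < 0) :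
    ∃ c : ℝ, ∀ i, ∃ ε₀ > 0, ∀ ε, 0 < ε → ε ≤ ε₀ →
      ∃ Γ, IsLimitCycle (lienard (f + C c) (derivative G) ε) Γ ∧ Γ ⊆ (s i).region := by
  set φ : ℝ → ℝ := fun a => melnikov G f a / melnikov G 1 a with hφ
  have hpos : ∀ i, ∀ a ∈ Icc (s i).l₂ (s i).l₁, 0 < melnikov G 1 a := fun i a ha => by
    obtain ⟨b, -, hb⟩ := (s i).exists_oval ha
    rw [hb.melnikov_eq]
    exact hb.abelian_one_pos
  have hφd : ∀ i, DifferentiableOn ℝ φ (Icc (s i).l₂ (s i).l₁) := fun i =>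
    ((s i).differentiableOn_melnikov f).div ((s i).differentiableOn_melnikov 1)
      fun a ha => (hpos i a ha).ne'
  set A : ι → Set ℝ := fun i => {a | a ∈ Ioo (s i).l₂ (s i).l₁ ∧ HasDerivAt φ 0 a} with hA
  have hnull : ∀ i, volume (φ '' A i) = 0 := fun i =>
    addHaar_image_eq_zero_of_det_fderivWithin_eq_zero volume (f' := fun _ => 0)
      (fun a ha => by simpa using ha.2.hasFDerivAt.hasFDerivWithinAt)
      (fun a _ => by simp [ContinuousLinearMap.det])
  have hae : ∀ᵐ v : ℝ, ∀ i, v ∉ φ '' A i :=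
    ae_all_iff.2 fun i => measure_eq_zero_iff_ae_notMem.1 (hnull i)
  have hsign : ∀ i, φ (s i).l₁ * φ (s i).l₂ < 0 := fun i => by
    have h1 := hpos i _ (right_mem_Icc.2 (s i).left_lt.le)
    have h2 := hpos i _ (left_mem_Icc.2 (s i).left_lt.le)
    have h3 := hs i
    rw [← (s i).oval_inner.melnikov_eq, ← (s i).oval_outer.melnikov_eq] at h3
    rw [hφ]
    simp only
    rw [div_mul_div_comm]
    exact div_neg_of_neg_of_pos h3 (mul_pos h1 h2)
  have hev : ∀ᶠ v in 𝓝 (0 : ℝ), ∀ i, (φ (s i).l₁ - v) * (φ (s i).l₂ - v) < 0 := by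
    refine eventually_all.2 fun i => ?_
    have : Continuous fun v : ℝ => (φ (s i).l₁ - v) * (φ (s i).l₂ - v) := by fun_prop
    exact this.continuousAt.eventually (gt_mem_nhds (by simpa using hsign i))
  obtain ⟨v, hv, hvA⟩ := mem_closure_iff_nhds.1
    ((Measure.dense_of_ae hae) 0) _ hev
  refine ⟨-v, fun i => ?_⟩
  have hv := hv i
  have hmem : v ∈ φ '' Ioo (s i).l₂ (s i).l₁ := by
    rcases mul_neg_iff.1 hv with ⟨h1, h2⟩ | ⟨h1, h2⟩
    · exact intermediate_value_Ioo (s i).left_lt.le (hφd i).continuousOn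
        ⟨by linarith, by linarith⟩
    · exact intermediate_value_Ioo' (s i).left_lt.le (hφd i).continuousOn
        ⟨by linarith, by linarith⟩
  obtain ⟨a, ha, hav⟩ := hmem
  have hnhds := Icc_mem_nhds ha.1 ha.2
  have hφa := ((hφd i).differentiableAt hnhds).hasDerivAt
  have hMa := (((s i).differentiableOn_melnikov 1).differentiableAt hnhds).hasDerivAt
  have hd0 : deriv φ a ≠ 0 := fun hcon => hvA i ⟨a, ⟨ha, hcon ▸ hφa⟩, hav⟩
  refine (s i).exists_limitCycle (f + C (-v)) (M := fun a => (φ a - v) * melnikov G 1 a)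
    (fun x hx b hb => ?_) ha (by simp [hav]) ((hφa.sub_const v).mul hMa) ?_
  · have h1 : C (-v) = C (-v) * (1 : ℝ[X]) := (mul_one _).symm
    rw [h1, abelian_add, abelian_C_mul, ← hb.melnikov_eq, ← hb.melnikov_eq, sub_mul, hφ]
    simp only
    rw [div_mul_cancel₀ _ (hpos i x (Ioo_subset_Icc_self hx)).ne']
    ring
  · rw [hav, sub_self, zero_mul, add_zero]
    exact mul_ne_zero hd0 (hpos i a (Ioo_subset_Icc_self ha)).ne'

theorem abelian_swap {G : ℝ[X]} {a b : ℝ} (h : G.eval a = G.eval b) (f : ℝ[X]) :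
    abelian G f b a = -abelian G f a b := by
  rw [abelian, abelian, intervalIntegral.integral_symm, h]

theorem abelian_comp (G f Q : ℝ[X]) (a b : ℝ) :
    abelian (G.comp Q) (derivative Q * f.comp Q) a b = abelian G f (Q.eval a) (Q.eval b) := by
  have h := intervalIntegral.integral_comp_mul_deriv (a := a) (b := b)
    (fun x _ => Q.hasDerivAt x) (derivative Q).continuous.continuousOn
    (continuous_abelian_integrand G f (G.eval (Q.eval a)))
  rw [abelian, abelian, ← h]
  refine intervalIntegral.integral_congr fun x _ => ?_
  simp only [Function.comp, eval_mul, eval_comp]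
  ring

namespace Slot

variable {G : ℝ[X]}

/-- The slot changes the sign of the Abelian integral of `f`. -/
def Alternates (s : Slot G) (f : ℝ[X]) : Prop :=
  abelian G f s.l₁ s.r₁ * abelian G f s.l₂ s.r₂ < 0

/-- The preimage of a slot under `x ↦ x² - A` in the right half plane. -/
noncomputable def pull (s : Slot G) {A : ℝ} (hA : 0 < s.l₂ + A) : Slot (G.comp (X ^ 2 - C A)) :=
  have h1 := s.left_lt
  have h2 := s.lt
  have h3 := s.right_lt
  have hsq : ∀ u, s.l₂ ≤ u → √(u + A) ^ 2 - A = u := fun u hu => by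
    rw [Real.sq_sqrt (by linarith)]; ring
  have hmem : ∀ u v x, s.l₂ ≤ u → u ≤ v → x ∈ Icc √(u + A) √(v + A) →
      0 < x ∧ x ^ 2 - A ∈ Icc u v := fun u v x hu huv hx => by
    have hx0 : 0 < x := (Real.sqrt_pos.2 (by linarith)).trans_le hx.1
    have h4 := (Real.sqrt_le_left hx0.le).1 hx.1
    have h5 := (Real.le_sqrt' hx0).1 hx.2
    exact ⟨hx0, by linarith, by linarith⟩
  { l₂ := √(s.l₂ + A)
    l₁ := √(s.l₁ + A)
    r₁ := √(s.r₁ + A)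
    r₂ := √(s.r₂ + A)
    left_lt := Real.sqrt_lt_sqrt hA.le (by linarith)
    lt := Real.sqrt_lt_sqrt (by linarith) (by linarith)
    right_lt := Real.sqrt_lt_sqrt (by linarith) (by linarith)
    inner_eq := by
      simp only [eval_comp, eval_sub, eval_pow, eval_X, eval_C]
      rw [hsq _ h1.le, hsq _ (by linarith), s.inner_eq]
    outer_eq := by
      simp only [eval_comp, eval_sub, eval_pow, eval_X, eval_C]
      rw [hsq _ le_rfl, hsq _ (by linarith), s.outer_eq]
    deriv_left := fun x hx => by
      obtain ⟨h4, h5⟩ := hmem _ _ x le_rfl h1.le hx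
      have := s.deriv_left _ h5
      simp only [derivative_comp, derivative_sub, derivative_X_pow, derivative_C, eval_mul,
        eval_comp, eval_sub, eval_pow, eval_X, eval_C, sub_zero]
      exact mul_neg_of_pos_of_neg (by simpa using h4) this
    deriv_right := fun x hx => by
      obtain ⟨h4, h5⟩ := hmem _ _ x (by linarith) h3.le hx
      have := s.deriv_right _ h5
      simp only [derivative_comp, derivative_sub, derivative_X_pow, derivative_C, eval_mul,
        eval_comp, eval_sub, eval_pow, eval_X, eval_C, sub_zero]
      exact mul_pos (by simpa using h4) this
    eval_lt := fun x hx => by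
      simp only [eval_comp, eval_sub, eval_pow, eval_X, eval_C]
      rw [hsq _ h1.le]
      have hx0 : 0 < x := (Real.sqrt_pos.2 (by linarith)).trans hx.1
      have h4 := (Real.sqrt_lt' hx0).1 hx.1
      have h5 := (Real.lt_sqrt hx0.le).1 hx.2
      exact s.eval_lt _ ⟨by linarith, by linarith⟩ }

theorem pull_alternates {s : Slot G} {f : ℝ[X]} (hs : s.Alternates f) {A : ℝ}
    (hA : 0 < s.l₂ + A) :
    (s.pull hA).Alternates (derivative (X ^ 2 - C A) * f.comp (X ^ 2 - C A)) := by
  have h1 := s.left_lt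
  have h2 := s.lt
  have h3 := s.right_lt
  have hsq : ∀ u, s.l₂ ≤ u → √(u + A) ^ 2 - A = u := fun u hu => by
    rw [Real.sq_sqrt (by linarith)]; ring
  simp only [Alternates, abelian_comp, pull, eval_sub, eval_pow, eval_X, eval_C]
  rw [hsq _ le_rfl, hsq _ h1.le, hsq _ (by linarith), hsq _ (by linarith)]
  exact hs

theorem eval_neg_of_comp_neg (hG : G.comp (-X) = G) (x : ℝ) : G.eval (-x) = G.eval x := by
  conv_rhs => rw [← hG]
  simp

theorem eval_derivative_neg_of_comp_neg (hG : G.comp (-X) = G) (x : ℝ) :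
    (derivative G).eval (-x) = -(derivative G).eval x := by
  conv_rhs => rw [← hG]
  simp [derivative_comp]

/-- The reflection of a slot of an even potential. -/
def mirror (s : Slot G) (hG : G.comp (-X) = G) : Slot G where
  l₂ := -s.r₂
  l₁ := -s.r₁
  r₁ := -s.l₁
  r₂ := -s.l₂
  left_lt := neg_lt_neg s.right_lt
  lt := neg_lt_neg s.lt
  right_lt := neg_lt_neg s.left_lt
  inner_eq := by simp only [eval_neg_of_comp_neg hG, s.inner_eq]
  outer_eq := by simp only [eval_neg_of_comp_neg hG, s.outer_eq]
  deriv_left x hx := by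
    have := s.deriv_right (-x) ⟨by linarith [hx.2], by linarith [hx.1]⟩
    rw [eval_derivative_neg_of_comp_neg hG] at this
    linarith
  deriv_right x hx := by
    have := s.deriv_left (-x) ⟨by linarith [hx.2], by linarith [hx.1]⟩
    rw [eval_derivative_neg_of_comp_neg hG] at this
    linarith
  eval_lt x hx := by
    have := s.eval_lt (-x) ⟨by linarith [hx.2], by linarith [hx.1]⟩
    rwa [eval_neg_of_comp_neg hG, s.inner_eq, ← eval_neg_of_comp_neg hG s.r₁] at this

theorem mirror_alternates {s : Slot G} {f : ℝ[X]} (hs : s.Alternates f) (hG : G.comp (-X) = G)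
    (hf : f.comp (-X) = -f) : (s.mirror hG).Alternates f := by
  have key : ∀ a b, G.eval a = G.eval b → abelian G f (-b) (-a) = -abelian G f a b := by
    intro a b hab
    have h1 := abelian_comp G f (-X) a b
    simp only [hG, hf, derivative_neg, derivative_X, eval_neg, eval_X, neg_mul, one_mul,
      neg_neg] at h1
    rw [h1, abelian_swap]
    simp only [eval_neg_of_comp_neg hG, hab]
  simp only [Alternates, mirror]
  rw [key _ _ s.inner_eq, key _ _ s.outer_eq, neg_mul_neg]
  exact hs

/-- A slot made of symmetric ovals. -/
def symmetric {a b : ℝ} (hab : a < b) (h : ∀ y ∈ Icc a b, Oval G (-y) y) : Slot G where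
  l₂ := -b
  l₁ := -a
  r₁ := a
  r₂ := b
  left_lt := neg_lt_neg hab
  lt := (h a (left_mem_Icc.2 hab.le)).lt
  right_lt := hab
  inner_eq := (h a (left_mem_Icc.2 hab.le)).eval_eq
  outer_eq := (h b (right_mem_Icc.2 hab.le)).eval_eq
  deriv_left x hx := by
    have := (h (-x) ⟨by linarith [hx.2], by linarith [hx.1]⟩).deriv_left
    rwa [neg_neg] at this
  deriv_right x hx := (h x hx).deriv_right
  eval_lt := (h a (left_mem_Icc.2 hab.le)).eval_lt

theorem Alternates.eventually {s : Slot G} {f : ℝ[X]} (hs : s.Alternates f) (h : ℝ[X]) :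
    ∀ᶠ c in 𝓝 (0 : ℝ), s.Alternates (f + C c * h) := by
  simp only [Alternates, abelian_add, abelian_C_mul]
  have h1 : Continuous fun c : ℝ => (abelian G f s.l₁ s.r₁ + c * abelian G h s.l₁ s.r₁) *
      (abelian G f s.l₂ s.r₂ + c * abelian G h s.l₂ s.r₂) := by fun_prop
  exact h1.continuousAt.eventually (gt_mem_nhds (by simpa [Alternates] using hs))

end Slot

theorem tendsto_eval_atTop {E : ℝ[X]} (hd : 0 < E.natDegree) (hl : 0 < E.leadingCoeff) :
    Tendsto (fun x => E.eval x) atTop atTop :=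
  E.tendsto_atTop_of_leadingCoeff_nonneg (natDegree_pos_iff_degree_pos.1 hd) hl.le

theorem eventually_eval_derivative_pos {E : ℝ[X]} (hd : 0 < E.natDegree)
    (hl : 0 < E.leadingCoeff) : ∀ᶠ x in atTop, 0 < (derivative E).eval x := by
  have hn : (derivative E).natDegree = E.natDegree - 1 := natDegree_derivative E
  have hlead : 0 < (derivative E).leadingCoeff := by
    rw [leadingCoeff_derivative]
    exact mul_pos hl (Nat.cast_pos.2 hd)
  rcases Nat.eq_zero_or_pos (derivative E).natDegree with h | h
  · rw [eq_C_of_natDegree_eq_zero h] at hlead ⊢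
    exact Eventually.of_forall fun x => by simpa using hlead
  · exact (tendsto_eval_atTop h hlead).eventually_gt_atTop 0

/-- Far away, the level curves of an even potential are symmetric ovals. -/
theorem eventually_oval_symmetric {E : ℝ[X]} (hd : 0 < E.natDegree) (hl : 0 < E.leadingCoeff) :
    ∀ᶠ y in atTop, Oval (E.comp (X ^ 2)) (-y) y := by
  obtain ⟨T, hT⟩ := eventually_atTop.1 (eventually_eval_derivative_pos hd hl)
  have hmono : StrictMonoOn (fun x => E.eval x) (Ici T) :=
    strictMonoOn_of_deriv_pos (convex_Ici _) E.continuous.continuousOn fun x hx => by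
      simpa using hT x (interior_subset hx)
  obtain ⟨B, hB⟩ := (isCompact_Icc (a := 0) (b := T)).bddAbove_image
    (E.continuous.continuousOn (s := Icc 0 T))
  have hsq : Tendsto (fun y : ℝ => y ^ 2) atTop atTop := tendsto_pow_atTop two_ne_zero
  filter_upwards [hsq.eventually ((tendsto_eval_atTop hd hl).eventually_gt_atTop B),
    hsq.eventually_ge_atTop T, eventually_gt_atTop 0] with y h1 h2 h3
  have h4 := hT _ h2
  refine ⟨by linarith, by simp, fun x hx => ?_, ?_, ?_⟩
  · have hxy : x ^ 2 < y ^ 2 := sq_lt_sq' hx.1 hx.2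
    simp only [eval_comp, eval_pow, eval_X, neg_sq]
    rcases le_or_gt (x ^ 2) T with h | h
    · exact (hB ⟨x ^ 2, ⟨sq_nonneg x, h⟩, rfl⟩).trans_lt h1
    · exact hmono h.le h2 hxy
  · simp only [derivative_comp, derivative_X_pow, eval_mul, eval_comp, eval_pow, eval_X, neg_sq]
    exact mul_neg_of_neg_of_pos (by simpa using h3) h4
  · simp only [derivative_comp, derivative_X_pow, eval_mul, eval_comp, eval_pow, eval_X]
    exact mul_pos (by simpa using h3) h4

/-- Far away, the Abelian integral of an even weight has the sign of the weight at infinity. -/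
theorem eventually_abelian_symmetric_pos {E e : ℝ[X]} (hd : 0 < E.natDegree)
    (hl : 0 < E.leadingCoeff) (hd' : 0 < e.natDegree) (hl' : 0 < e.leadingCoeff) :
    ∀ᶠ y in atTop, 0 < abelian (E.comp (X ^ 2)) (e.comp (X ^ 2)) (-y) y := by
  set G := E.comp (X ^ 2) with hG
  set q := e.comp (X ^ 2) with hq
  have hsq : Tendsto (fun y : ℝ => y ^ 2) atTop atTop := tendsto_pow_atTop two_ne_zero
  have hGy : Tendsto (fun y => G.eval y) atTop atTop := by
    simpa [hG, eval_comp] using! (tendsto_eval_atTop hd hl).comp hsq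
  obtain ⟨R, hR⟩ := eventually_atTop.1
    ((hsq.eventually ((tendsto_eval_atTop hd' hl').eventually_ge_atTop 1)).and
      (eventually_ge_atTop 0))
  have hqeval : ∀ x, q.eval x = e.eval (x ^ 2) := fun x => by simp [hq, eval_comp]
  have hR0 : 0 ≤ R := (hR R le_rfl).2
  have hq1 : ∀ x, R ≤ |x| → 1 ≤ q.eval x := fun x hx => by
    rw [hqeval, ← sq_abs]
    exact (hR _ hx).1
  have hqi : ∀ a b, IntervalIntegrable (fun x => q.eval x) volume a b := fun a b =>
    q.continuous.intervalIntegrable _ _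
  obtain ⟨N, hNR, hN⟩ : ∃ N, R ≤ N ∧ 0 < ∫ x in (-N)..N, q.eval x := by
    set J := ∫ x in (-R)..R, q.eval x with hJ
    refine ⟨R + |J| + 1, by linarith [abs_nonneg J], ?_⟩
    set N := R + |J| + 1 with hN
    have hRN : R ≤ N := by linarith [abs_nonneg J]
    have h1 : N - R ≤ ∫ x in R..N, q.eval x := by
      have := intervalIntegral.integral_mono_on (f := fun _ => (1 : ℝ)) hRN (by simp) (hqi R N)
        fun x hx => hq1 x (hx.1.trans (le_abs_self x))
      simpa using this
    have h2 : 0 ≤ ∫ x in (-N)..(-R), q.eval x :=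
      intervalIntegral.integral_nonneg (by linarith) fun x hx =>
        zero_le_one.trans (hq1 x (by linarith [hx.2, neg_le_abs x]))
    rw [← intervalIntegral.integral_add_adjacent_intervals (hqi (-N) (-R)) (hqi (-R) N),
      ← intervalIntegral.integral_add_adjacent_intervals (hqi (-R) R) (hqi R N)]
    linarith [neg_abs_le J]
  have hcont : Continuous fun t : ℝ => ∫ x in (-N)..N, q.eval x * √(1 - t * G.eval x) :=
    intervalIntegral.continuous_parametric_intervalIntegral_of_continuous'
      (by unfold Function.uncurry; fun_prop) _ _
  have hev : ∀ᶠ t in 𝓝 (0 : ℝ), 0 < ∫ x in (-N)..N, q.eval x * √(1 - t * G.eval x) :=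
    hcont.continuousAt.eventually (lt_mem_nhds (by simpa using hN))
  filter_upwards [(tendsto_inv_atTop_zero.comp hGy).eventually hev, hGy.eventually_gt_atTop 0,
    eventually_ge_atTop N] with y h1 h2 h3
  simp only [Function.comp] at h1
  have hi : ∀ a b, IntervalIntegrable (fun x => q.eval x * √(2 * (G.eval y - G.eval x)))
      volume a b := fun a b => (continuous_abelian_integrand G q _).intervalIntegrable _ _
  have hGneg : G.eval (-y) = G.eval y := by simp [hG, eval_comp]
  have hmid : 0 < ∫ x in (-N)..N, q.eval x * √(2 * (G.eval y - G.eval x)) := by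
    have h4 : ∀ x, q.eval x * √(2 * (G.eval y - G.eval x)) =
        √(2 * G.eval y) * (q.eval x * √(1 - (G.eval y)⁻¹ * G.eval x)) := fun x => by
      have h5 : 2 * (G.eval y - G.eval x) = 2 * G.eval y * (1 - (G.eval y)⁻¹ * G.eval x) := by
        field_simp
      rw [h5, Real.sqrt_mul (by linarith)]
      ring
    simp only [h4, intervalIntegral.integral_const_mul]
    exact mul_pos (Real.sqrt_pos.2 (by linarith)) h1
  have hleft : 0 ≤ ∫ x in (-y)..(-N), q.eval x * √(2 * (G.eval y - G.eval x)) :=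
    intervalIntegral.integral_nonneg (by linarith) fun x hx =>
      mul_nonneg (zero_le_one.trans (hq1 x (by linarith [hx.2, neg_le_abs x]))) (Real.sqrt_nonneg _)
  have hright : 0 ≤ ∫ x in N..y, q.eval x * √(2 * (G.eval y - G.eval x)) :=
    intervalIntegral.integral_nonneg (by linarith) fun x hx =>
      mul_nonneg (zero_le_one.trans (hq1 x (by linarith [hx.1, le_abs_self x])))
        (Real.sqrt_nonneg _)
  rw [abelian, hGneg, ← intervalIntegral.integral_add_adjacent_intervals (hi (-y) (-N)) (hi (-N) y),
    ← intervalIntegral.integral_add_adjacent_intervals (hi (-N) N) (hi N y)]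
  linarith

/-- Small even perturbations create symmetric ovals with alternating Abelian integrals, without
destroying finitely many existing sign changes. -/
theorem exists_even_perturbation {E G f : ℝ[X]} (hG : E.comp (X ^ 2) = G)
    (hd : 0 < E.natDegree) (hl : 0 < E.leadingCoeff)
    (hf : ∀ y, abelian G f (-y) y = 0) {ι : Type*} [Finite ι]
    (t : ι → Slot G) (ht : ∀ i, (t i).Alternates f) (S : ℝ) (j : ℕ) :
    ∃ e : ℝ[X], e.natDegree ≤ j ∧ (∀ i, (t i).Alternates (f + e.comp (X ^ 2))) ∧
      ∃ y : ℕ → ℝ, StrictMonoOn y (Iic j) ∧ ∀ i ≤ j, S < y i ∧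
        0 < (-1) ^ i * abelian G (f + e.comp (X ^ 2)) (-y i) (y i) := by
  subst hG
  induction j with
  | zero =>
    obtain ⟨c, hc, hc0⟩ := ((eventually_all.2 fun i => (ht i).eventually 1).filter_mono
      nhdsWithin_le_nhds |>.and (self_mem_nhdsWithin (a := (0 : ℝ)) (s := Ioi 0))).exists
    obtain ⟨y, hy, hyS⟩ :=
      ((eventually_oval_symmetric hd hl).and (eventually_gt_atTop S)).exists
    have hC : (C c).comp (X ^ 2) = C c * (1 : ℝ[X]) := by simp
    refine ⟨C c, by simp, by rw [hC]; exact hc, fun _ => y, fun a ha b hb hab => ?_, ?_⟩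
    · simp only [mem_Iic, Nat.le_zero] at ha hb
      omega
    · intro i hi
      rw [Nat.le_zero.1 hi, hC, abelian_add, abelian_C_mul, hf, pow_zero, one_mul, zero_add]
      exact ⟨hyS, mul_pos hc0 hy.abelian_one_pos⟩
  | succ j ih =>
    obtain ⟨e, he, het, y, hy, hyS⟩ := ih
    set τ : ℝ := (-1) ^ (j + 1) with hτ
    have hττ : τ * τ = 1 := by rw [hτ, ← mul_pow]; simp
    set h : ℝ[X] := C τ * X ^ (2 * (j + 1)) with hh
    have hev : ∀ᶠ c in 𝓝 (0 : ℝ), ∀ i : Fin (j + 1), 0 < (-1) ^ (i : ℕ) *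
        abelian (E.comp (X ^ 2)) (f + e.comp (X ^ 2) + C c * h) (-y i) (y i) := by
      refine eventually_all.2 fun i => ?_
      simp only [abelian_add _ (f + _), abelian_C_mul]
      have h1 : Continuous fun c : ℝ => (-1) ^ (i : ℕ) *
        (abelian (E.comp (X ^ 2)) (f + e.comp (X ^ 2)) (-y i) (y i) +
          c * abelian (E.comp (X ^ 2)) h (-y i) (y i)) := by fun_prop
      exact h1.continuousAt.eventually (lt_mem_nhds (by
        simpa using (hyS i (Nat.lt_succ_iff.1 i.2)).2))
    obtain ⟨c, ⟨hct, hcy⟩, hc0⟩ := ((((eventually_all.2 fun i => (het i).eventually h).and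
      hev).filter_mono nhdsWithin_le_nhds).and
        (self_mem_nhdsWithin (a := (0 : ℝ)) (s := Ioi 0))).exists
    have hc0 : 0 < c := hc0
    set e' : ℝ[X] := e + C (c * τ) * X ^ (j + 1) with he'
    have hcomp : f + e'.comp (X ^ 2) = f + e.comp (X ^ 2) + C c * h := by
      simp only [he', hh, add_comp, mul_comp, C_comp, pow_comp, X_comp, C_mul, ← pow_mul]
      ring
    have hτ0 : τ ≠ 0 := fun h0 => by simp [h0] at hττ
    have hlt : e.natDegree < (C (c * τ) * X ^ (j + 1) : ℝ[X]).natDegree := by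
      rw [natDegree_C_mul_X_pow _ _ (mul_ne_zero hc0.ne' hτ0)]
      omega
    have hn : e'.natDegree = j + 1 := by
      rw [he', natDegree_add_eq_right_of_natDegree_lt hlt,
        natDegree_C_mul_X_pow _ _ (mul_ne_zero hc0.ne' hτ0)]
    have hlc : e'.leadingCoeff = c * τ := by
      rw [he', leadingCoeff_add_of_degree_lt (degree_lt_degree hlt), leadingCoeff_C_mul_X_pow]
    have hτe : (C τ * e').natDegree = j + 1 := by rw [natDegree_C_mul hτ0, hn]
    obtain ⟨z, hz, hzy, hzS⟩ := ((eventually_abelian_symmetric_pos hd hl (e := C τ * e')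
      (by rw [hτe]; omega) (by
        rw [leadingCoeff_mul, leadingCoeff_C, hlc]
        calc 0 < c := hc0
          _ = τ * (c * τ) := by linear_combination (-c) * hττ)).and
      ((eventually_gt_atTop (y j)).and (eventually_gt_atTop S))).exists
    have hupd : ∀ i ≤ j, Function.update y (j + 1) z i = y i := fun i hi =>
      Function.update_of_ne (by omega) _ _
    refine ⟨e', hn.le, by rw [hcomp]; exact hct, Function.update y (j + 1) z, ?_, ?_⟩
    · intro a ha b hb hab
      simp only [mem_Iic] at ha hb
      rw [hupd a (by omega)]
      rcases hb.eq_or_lt with rfl | hb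
      · rw [Function.update_self]
        exact (hy.monotoneOn (mem_Iic.2 (by omega)) (mem_Iic.2 le_rfl) (by omega)).trans_lt hzy
      · rw [hupd b (by omega)]
        exact hy (mem_Iic.2 (by omega)) (mem_Iic.2 (by omega)) hab
    · intro i hi
      rcases hi.eq_or_lt with rfl | hi
      · rw [Function.update_self, abelian_add, hf, zero_add]
        rw [mul_comp, C_comp, abelian_C_mul] at hz
        exact ⟨hzS, hz⟩
      · rw [hupd i (by omega), hcomp]
        exact ⟨(hyS i (by omega)).1, hcy ⟨i, hi⟩⟩

namespace Slot

variable {G : ℝ[X]}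

/-- The left turning points of the ovals of a slot. -/
def left (s : Slot G) : Set ℝ := Ioo s.l₂ s.l₁

/-- The right turning points of the ovals of a slot. -/
def right (s : Slot G) : Set ℝ := Ioo s.r₁ s.r₂

theorem of_mem_pull_left {s : Slot G} {A : ℝ} (hA : 0 < s.l₂ + A) {x : ℝ}
    (hx : x ∈ (s.pull hA).left) : 0 < x ∧ x ^ 2 - A ∈ s.left := by
  obtain ⟨h1, h2⟩ : √(s.l₂ + A) < x ∧ x < √(s.l₁ + A) := hx
  have hx0 : 0 < x := (Real.sqrt_pos.2 hA).trans h1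
  have h4 := (Real.sqrt_lt' hx0).1 h1
  have h5 := (Real.lt_sqrt hx0.le).1 h2
  exact ⟨hx0, by linarith, by linarith⟩

theorem of_mem_pull_right {s : Slot G} {A : ℝ} (hA : 0 < s.l₂ + A) {x : ℝ}
    (hx : x ∈ (s.pull hA).right) : 0 < x ∧ x ^ 2 - A ∈ s.right := by
  obtain ⟨h1, h2⟩ : √(s.r₁ + A) < x ∧ x < √(s.r₂ + A) := hx
  have hx0 : 0 < x := (Real.sqrt_pos.2 (by linarith [s.left_lt, s.lt])).trans h1
  have h4 := (Real.sqrt_lt' hx0).1 h1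
  have h5 := (Real.lt_sqrt hx0.le).1 h2
  exact ⟨hx0, by linarith, by linarith⟩

theorem of_mem_mirror_left {s : Slot G} (hG : G.comp (-X) = G) {x : ℝ}
    (hx : x ∈ (s.mirror hG).left) : -x ∈ s.right := by
  obtain ⟨h1, h2⟩ : -s.r₂ < x ∧ x < -s.r₁ := hx
  exact ⟨by linarith, by linarith⟩

theorem of_mem_mirror_right {s : Slot G} (hG : G.comp (-X) = G) {x : ℝ}
    (hx : x ∈ (s.mirror hG).right) : -x ∈ s.left := by
  obtain ⟨h1, h2⟩ : -s.l₁ < x ∧ x < -s.l₂ := hx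
  exact ⟨by linarith, by linarith⟩

theorem of_mem_symmetric_left {a b : ℝ} (hab : a < b) (h : ∀ y ∈ Icc a b, Oval G (-y) y) {x : ℝ}
    (hx : x ∈ (symmetric hab h).left) : -x ∈ Ioo a b := by
  obtain ⟨h1, h2⟩ : -b < x ∧ x < -a := hx
  exact ⟨by linarith, by linarith⟩

end Slot

/-- `N` slots with disjoint windows, each changing the sign of the Abelian integral of `f`. -/
def HasSlots (G f : ℝ[X]) (N : ℕ) : Prop :=
  ∃ (ι : Type) (_ : Fintype ι) (s : ι → Slot G), Fintype.card ι = N ∧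
    (∀ i, (s i).Alternates f) ∧
    (∀ i j x, x ∈ (s i).left → x ∈ (s j).left → i = j) ∧
    ∀ i j x, x ∈ (s i).right → x ∈ (s j).right → i = j

theorem HasSlots.hGe {G f : ℝ[X]} {N n m : ℕ} (h : HasSlots G f N) (hf : f.natDegree ≤ n)
    (hg : (derivative G).natDegree ≤ m) : HGe n m N := by
  classical
  obtain ⟨ι, _, s, hcard, hs, hleft, -⟩ := h
  obtain ⟨c, hc⟩ := exists_generic_shift s f hs
  choose ε₀ hε₀ hcyc using hc
  obtain ⟨δ, hδ, hδ0⟩ : ∃ δ : ℝ, (∀ i, δ ≤ ε₀ i) ∧ 0 < δ :=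
    ((eventually_all.2 fun i => (eventually_le_nhds (hε₀ i)).filter_mono
      nhdsWithin_le_nhds).and (self_mem_nhdsWithin (a := (0 : ℝ)) (s := Ioi 0))).exists
  refine ⟨f + C c, derivative G, ?_, hg, δ, hδ0, fun ε hε hεδ => ?_⟩
  · rwa [natDegree_add_C]
  choose Γ hΓ hsub using fun i => hcyc i ε hε (hεδ.trans (hδ i))
  have hinj : Function.Injective Γ := fun i j hij => by
    obtain ⟨a, ha, haΓ, hamin⟩ := (s i).exists_leftmost (hΓ i).1 (hsub i)
    obtain ⟨b, hb, hbΓ, hbmin⟩ := (s j).exists_leftmost (hΓ j).1 (hsub j)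
    rw [← hij] at hbΓ hbmin
    have hab : a = b := le_antisymm (hamin _ hbΓ) (hbmin _ haΓ)
    exact hleft i j a ha (hab ▸ hb)
  refine ⟨Finset.univ.image Γ, fun Γ' hΓ' => ?_, ?_⟩
  · obtain ⟨i, -, rfl⟩ := Finset.mem_image.1 hΓ'
    exact hΓ i
  · rw [Finset.card_image_of_injective _ hinj, Finset.card_univ, hcard]

theorem eq_of_mem_Ioo_of_strictMonoOn {y : ℕ → ℝ} {j : ℕ} (hy : StrictMonoOn y (Iic j))
    {i i' : Fin j} {x : ℝ} (hx : x ∈ Ioo (y i) (y (i + 1))) (hx' : x ∈ Ioo (y i') (y (i' + 1))) :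
    i = i' := by
  have key : ∀ {i i' : Fin j}, x ∈ Ioo (y i) (y (i + 1)) → x ∈ Ioo (y i') (y (i' + 1)) →
      ¬ i < i' := fun {i i'} hx hx' hlt => by
    have := hy.monotoneOn (mem_Iic.2 (show (i : ℕ) + 1 ≤ j by omega))
      (mem_Iic.2 (show (i' : ℕ) ≤ j by omega)) (by omega)
    linarith [hx.2, hx'.1]
  exact le_antisymm (not_lt.1 (key hx' hx)) (not_lt.1 (key hx hx'))

/-- Folding the potential by `x ↦ x² - A` doubles the slots, and an even perturbation of the weight
creates `j` additional ones. -/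
theorem HasSlots.fold {G f : ℝ[X]} {N : ℕ} (h : HasSlots G f N) (hd : 0 < G.natDegree)
    (hl : 0 < G.leadingCoeff) (j : ℕ) :
    ∃ (A : ℝ) (e : ℝ[X]), e.natDegree ≤ j ∧ (j = 0 → e = 0) ∧
      HasSlots (G.comp (X ^ 2 - C A))
        (derivative (X ^ 2 - C A) * f.comp (X ^ 2 - C A) + e.comp (X ^ 2)) (2 * N + j) := by
  obtain ⟨ι, _, s, hcard, hs, hleft, hright⟩ := h
  obtain ⟨A, hA⟩ : ∃ A : ℝ, ∀ i, 0 < (s i).l₂ + A :=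
    (eventually_all.2 fun i =>
      (tendsto_const_nhds.add_atTop tendsto_id).eventually_gt_atTop 0).exists
  set Q : ℝ[X] := X ^ 2 - C A with hQ
  have hQe : Q.comp (-X) = Q := by simp [hQ]
  set E : ℝ[X] := G.comp (X - C A) with hE
  have hEG : E.comp (X ^ 2) = G.comp Q := by simp [hE, hQ, comp_assoc]
  have hEd : 0 < E.natDegree := by rw [hE, natDegree_comp, natDegree_X_sub_C, mul_one]; exact hd
  have hEl : 0 < E.leadingCoeff := by
    rw [hE, leadingCoeff_comp (by simp), leadingCoeff_X_sub_C, one_pow, mul_one]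
    exact hl
  have hGe : (G.comp Q).comp (-X) = G.comp Q := by rw [comp_assoc, hQe]
  set F : ℝ[X] := derivative Q * f.comp Q with hF
  have hFo : F.comp (-X) = -F := by
    rw [hF, mul_comp, comp_assoc, hQe]
    simp [hQ]
  have hF0 : ∀ y, abelian (G.comp Q) F (-y) y = 0 := fun y => by
    rw [hF, abelian_comp, show Q.eval (-y) = Q.eval y by simp [hQ], abelian,
      intervalIntegral.integral_same]
  set t : ι ⊕ ι → Slot (G.comp Q) :=
    Sum.elim (fun i => (s i).pull (hA i)) fun i => ((s i).pull (hA i)).mirror hGe with ht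
  have hta : ∀ i, (t i).Alternates F := by
    rintro (i | i)
    · exact Slot.pull_alternates (hs i) (hA i)
    · exact Slot.mirror_alternates (Slot.pull_alternates (hs i) (hA i)) hGe hFo
  have hoval := eventually_oval_symmetric hEd hEl
  rw [hEG] at hoval
  obtain ⟨S₀, hS₀⟩ := eventually_atTop.1 hoval
  obtain ⟨S, hSpull, hSS₀, hS⟩ : ∃ S : ℝ, (∀ i, ((s i).pull (hA i)).r₂ < S) ∧ S₀ ≤ S ∧ 0 ≤ S :=
    ((eventually_all.2 fun i => eventually_gt_atTop ((s i).pull (hA i)).r₂).and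
      ((eventually_ge_atTop S₀).and (eventually_ge_atTop 0))).exists
  obtain ⟨e, hej, he0, hte, y, hy, hyS, hya⟩ : ∃ e : ℝ[X], e.natDegree ≤ j ∧ (j = 0 → e = 0) ∧
      (∀ i, (t i).Alternates (F + e.comp (X ^ 2))) ∧
      ∃ y : ℕ → ℝ, StrictMonoOn y (Iic j) ∧ (∀ i ≤ j, S < y i) ∧
        ∀ i < j, abelian (G.comp Q) (F + e.comp (X ^ 2)) (-y i) (y i) *
          abelian (G.comp Q) (F + e.comp (X ^ 2)) (-y (i + 1)) (y (i + 1)) < 0 := by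
    rcases Nat.eq_zero_or_pos j with rfl | hj
    · refine ⟨0, by simp, fun _ => rfl, by simpa using hta, fun _ => S + 1, ?_, by simp, by simp⟩
      intro a ha b hb hab
      simp only [mem_Iic, Nat.le_zero] at ha hb
      omega
    · obtain ⟨e, he, hte, y, hy, hyS⟩ := exists_even_perturbation hEG hEd hEl hF0 t hta S j
      refine ⟨e, he, fun h0 => absurd h0 hj.ne', hte, y, hy, fun i hi => (hyS i hi).1,
        fun i hi => ?_⟩
      have h1 := (hyS i hi.le).2
      have h2 := (hyS (i + 1) hi).2
      rcases neg_one_pow_eq_or ℝ i with h | h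
      · rw [pow_succ, h] at h2
        rw [h] at h1
        exact mul_neg_of_pos_of_neg (by linarith) (by linarith)
      · rw [pow_succ, h] at h2
        rw [h] at h1
        exact mul_neg_of_neg_of_pos (by linarith) (by linarith)
  have hylt : ∀ i : Fin j, y i < y (i + 1) := fun i =>
    hy (mem_Iic.2 i.2.le) (mem_Iic.2 (Nat.succ_le_of_lt i.2)) (Nat.lt_succ_self _)
  have hyo : ∀ i : Fin j, ∀ z ∈ Icc (y i) (y (i + 1)), Oval (G.comp Q) (-z) z := fun i z hz =>
    hS₀ z (hSS₀.trans ((hyS i i.2.le).le.trans hz.1))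
  have hsep : ∀ (i : ι) (i' : Fin j) x, x ∈ ((s i).pull (hA i)).right →
      x ∉ Ioo (y i') (y (i' + 1)) := fun i i' x hx hx' =>
    (hx.2.trans ((hSpull i).trans ((hyS i' i'.2.le).trans hx'.1))).false
  have hy0 : ∀ (i : Fin j) x, x ∈ Ioo (y i) (y (i + 1)) → 0 < x := fun i x hx =>
    hS.trans_lt ((hyS i i.2.le).trans hx.1)
  refine ⟨A, e, hej, he0, (ι ⊕ ι) ⊕ Fin j, inferInstance,
    Sum.elim t fun i => Slot.symmetric (hylt i) (hyo i), ?_, ?_, ?_, ?_⟩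
  · simp only [Fintype.card_sum, Fintype.card_fin, hcard, two_mul]
  · rintro (i | i)
    · exact hte i
    · exact hya i i.2
  · rintro ((i | i) | i) ((i' | i') | i') x hx hx' <;>
      simp only [ht, Sum.elim_inl, Sum.elim_inr] at hx hx'
    · rw [hleft i i' _ (Slot.of_mem_pull_left _ hx).2 (Slot.of_mem_pull_left _ hx').2]
    · have h1 := (Slot.of_mem_pull_left _ hx).1
      have h2 := (Slot.of_mem_pull_right _ (Slot.of_mem_mirror_left _ hx')).1
      linarith
    · have h1 := (Slot.of_mem_pull_left _ hx).1
      have h2 := hy0 _ _ (Slot.of_mem_symmetric_left _ _ hx')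
      linarith
    · have h1 := (Slot.of_mem_pull_left _ hx').1
      have h2 := (Slot.of_mem_pull_right _ (Slot.of_mem_mirror_left _ hx)).1
      linarith
    · rw [hright i i' _ (Slot.of_mem_pull_right _ (Slot.of_mem_mirror_left _ hx)).2
        (Slot.of_mem_pull_right _ (Slot.of_mem_mirror_left _ hx')).2]
    · exact absurd (Slot.of_mem_symmetric_left _ _ hx')
        (hsep i i' _ (Slot.of_mem_mirror_left _ hx))
    · have h1 := (Slot.of_mem_pull_left _ hx').1
      have h2 := hy0 _ _ (Slot.of_mem_symmetric_left _ _ hx)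
      linarith
    · exact absurd (Slot.of_mem_symmetric_left _ _ hx)
        (hsep i' i _ (Slot.of_mem_mirror_left _ hx'))
    · rw [eq_of_mem_Ioo_of_strictMonoOn hy (Slot.of_mem_symmetric_left _ _ hx)
        (Slot.of_mem_symmetric_left _ _ hx')]
  · rintro ((i | i) | i) ((i' | i') | i') x hx hx' <;>
      simp only [ht, Sum.elim_inl, Sum.elim_inr] at hx hx'
    · rw [hright i i' _ (Slot.of_mem_pull_right _ hx).2 (Slot.of_mem_pull_right _ hx').2]
    · have h1 := (Slot.of_mem_pull_right _ hx).1
      have h2 := (Slot.of_mem_pull_left _ (Slot.of_mem_mirror_right _ hx')).1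
      linarith
    · exact absurd hx' (hsep i i' x hx)
    · have h1 := (Slot.of_mem_pull_right _ hx').1
      have h2 := (Slot.of_mem_pull_left _ (Slot.of_mem_mirror_right _ hx)).1
      linarith
    · rw [hleft i i' _ (Slot.of_mem_pull_left _ (Slot.of_mem_mirror_right _ hx)).2
        (Slot.of_mem_pull_left _ (Slot.of_mem_mirror_right _ hx')).2]
    · have h1 := (Slot.of_mem_pull_left _ (Slot.of_mem_mirror_right _ hx)).1
      have h2 := hy0 i' x hx'
      linarith
    · exact absurd hx (hsep i' i x hx')
    · have h1 := (Slot.of_mem_pull_left _ (Slot.of_mem_mirror_right _ hx')).1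
      have h2 := hy0 i x hx
      linarith
    · rw [eq_of_mem_Ioo_of_strictMonoOn hy hx hx']

/-- The number of slots after `p` foldings. -/
def slotCount (r k : ℕ) : ℕ → ℕ
  | 0 => 0
  | p + 1 => 2 * slotCount r k p + (2 ^ (p + 1) * (k + 1) - 2 - r) / 2

theorem le_slotCount (r k p : ℕ) :
    (p : ℤ) * 2 ^ p * (k + 1) ≤
      2 * slotCount r k p + 2 * (2 ^ p - 1) * (2 + ((r / 2 : ℕ) : ℤ)) := by
  induction p with
  | zero => simp [slotCount]
  | succ p ih =>
    have h1 : (2 ^ (p + 1) * (k + 1) : ℤ) ≤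
        2 * (((2 ^ (p + 1) * (k + 1) - 2 - r) / 2 : ℕ) : ℤ) + 4 + 2 * ((r / 2 : ℕ) : ℤ) := by
      have h2 : 2 ^ (p + 1) * (k + 1) = 2 * (2 ^ p * (k + 1)) := by ring
      have h3 : (2 ^ (p + 1) * (k + 1) : ℤ) = ((2 ^ (p + 1) * (k + 1) : ℕ) : ℤ) := by
        push_cast; ring
      rw [h3, h2]
      generalize 2 ^ p * (k + 1) = n
      omega
    rw [slotCount]
    push_cast at h1 ih ⊢
    rw [pow_succ] at h1 ⊢
    linarith

theorem exists_hasSlots (k : ℕ) {r : ℕ} (hr : 1 ≤ r) (p : ℕ) :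
    ∃ G f : ℝ[X], G.natDegree = 2 ^ p ∧ 0 < G.leadingCoeff ∧
      (f = 0 ∨ f.natDegree + r + 2 ≤ 2 ^ p * (k + 1)) ∧ HasSlots G f (slotCount r k p) := by
  induction p with
  | zero =>
    exact ⟨X, 0, by simp, by simp, Or.inl rfl, Fin 0, inferInstance, Fin.elim0, rfl,
      fun i => i.elim0, fun i => i.elim0, fun i => i.elim0⟩
  | succ p ih =>
    obtain ⟨G, f, hGd, hGl, hf, hslots⟩ := ih
    set j := (2 ^ (p + 1) * (k + 1) - 2 - r) / 2 with hj
    obtain ⟨A, e, he, he0, h⟩ := hslots.fold (by rw [hGd]; positivity) hGl j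
    have hQ : (X ^ 2 - C A : ℝ[X]).natDegree = 2 := natDegree_X_pow_sub_C
    refine ⟨_, _, ?_, ?_, ?_, h⟩
    · rw [natDegree_comp, hQ, hGd, pow_succ]
    · rw [leadingCoeff_comp (by rw [hQ]; norm_num), leadingCoeff_X_pow_sub_C two_pos, one_pow,
        mul_one]
      exact hGl
    have h2 : 2 ^ (p + 1) * (k + 1) = 2 * (2 ^ p * (k + 1)) := by ring
    have hed : (e.comp (X ^ 2 : ℝ[X])).natDegree ≤ 2 * j := by
      rw [natDegree_comp, natDegree_X_pow, mul_comm]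
      gcongr
    rw [h2] at hj ⊢
    generalize 2 ^ p * (k + 1) = n at hj hf ⊢
    have hed0 : j ≠ 0 → (e.comp (X ^ 2 : ℝ[X])).natDegree + r + 2 ≤ 2 * n := by omega
    have hfd : f ≠ 0 → (derivative (X ^ 2 - C A) * f.comp (X ^ 2 - C A)).natDegree + r + 2 ≤
        2 * n := fun hf0 => by
      have h3 := hf.resolve_left hf0
      have h4 : (derivative (X ^ 2 - C A) * f.comp (X ^ 2 - C A)).natDegree ≤
          1 + f.natDegree * 2 := by
        refine natDegree_mul_le.trans (add_le_add ?_ ?_)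
        · exact (natDegree_derivative_le _).trans (by rw [hQ])
        · rw [natDegree_comp, hQ]
      omega
    by_cases hf0 : f = 0
    · rw [hf0, zero_comp, mul_zero, zero_add]
      by_cases hj0 : j = 0
      · left
        rw [he0 hj0, zero_comp]
      · exact Or.inr (hed0 hj0)
    · by_cases hj0 : j = 0
      · rw [he0 hj0, zero_comp, add_zero]
        exact Or.inr (hfd hf0)
      · have h3 := natDegree_add_le (derivative (X ^ 2 - C A) * f.comp (X ^ 2 - C A))
          (e.comp (X ^ 2 : ℝ[X]))
        have h4 := hed0 hj0
        have h5 := hfd hf0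
        right
        omega

end Lienard

theorem stmt14 (r k : ℕ) (hr : 1 ≤ r) (hk : 2 ≤ k) :
    ∃ Bbar : ℝ,
      Bbar ≥ -((2 + ((r / 2 : ℕ) : ℝ)) / ((k : ℝ) + 1)
        + Real.log ((k : ℝ) + 1) / (2 * Real.log 2)) ∧
      ∀ p : ℕ, 1 ≤ p → ∀ m : ℕ, m = 2 ^ p * (k + 1) - 2 → r < m →
        HGe (m - r) m
          (((m : ℝ) + 2) * Real.log ((m : ℝ) + 2) / (2 * Real.log 2)
            + Bbar * ((m : ℝ) + 2) + 2 + ((r / 2 : ℕ) : ℝ)) := by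
  refine ⟨_, le_rfl, fun p hp m hm hrm => ?_⟩
  obtain ⟨G, f, hGd, -, hf, h⟩ := Lienard.exists_hasSlots k hr p
  have hm2 : m + 2 = 2 ^ p * (k + 1) := by omega
  have hpow : 2 ^ p * 3 ≤ 2 ^ p * (k + 1) := by gcongr; omega
  have hpow1 : 1 ≤ 2 ^ p := Nat.one_le_two_pow
  obtain ⟨F, g, hF, hg, ε₀, hε₀, hcyc⟩ := h.hGe (n := m - r) (m := m)
    (by
      rcases hf with rfl | hf
      · simp
      · omega)
    ((natDegree_derivative_le G).trans (by omega))
  refine ⟨F, g, hF, hg, ε₀, hε₀, fun ε hε hεle => ?_⟩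
  obtain ⟨S, hS, hcard⟩ := hcyc ε hε hεle
  refine ⟨S, hS, le_trans ?_ hcard⟩
  have hmR : (m : ℝ) + 2 = 2 ^ p * ((k : ℝ) + 1) := by exact_mod_cast hm2
  have hk0 : (k : ℝ) + 1 ≠ 0 := by positivity
  have hlog2 : Real.log 2 ≠ 0 := (Real.log_pos one_lt_two).ne'
  have hcount : (p : ℝ) * 2 ^ p * (k + 1) ≤
      2 * Lienard.slotCount r k p + 2 * (2 ^ p - 1) * (2 + ((r / 2 : ℕ) : ℝ)) := by
    exact_mod_cast Lienard.le_slotCount r k p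
  rw [hmR, Real.log_mul (by positivity) hk0, Real.log_pow]
  have hid : 2 ^ p * ((k : ℝ) + 1) * (p * Real.log 2 + Real.log (k + 1)) / (2 * Real.log 2) +
      -((2 + ((r / 2 : ℕ) : ℝ)) / (k + 1) + Real.log (k + 1) / (2 * Real.log 2)) *
        (2 ^ p * (k + 1)) + 2 + ((r / 2 : ℕ) : ℝ) =
      ((p : ℝ) * 2 ^ p * (k + 1) - 2 * (2 ^ p - 1) * (2 + ((r / 2 : ℕ) : ℝ))) / 2 := by
    field_simp
    ring
  rw [hid]
  linarith
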